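/- arXiv:2507.18211 — 4 statements merged into one kernel-verified Lean document; each statement's English description precedes it below -/
import Mathlib

section
/- Let −3 < γ ≤ 1 and let k_α : ℝ³ × ℝ³ → ℝ be a measurable kernel for which there exist constants C₀ > 0 and α₁, α₂, α₃ > 0 such that for all v ≠ v_*, both |k_α(v, v_*)| ≤ C₀ w_γ(|v − v_*|) (1 + |v| + |v_*|)^{γ−1} e^{−α₁ |v − v_*|²} e^{−α₃ ((v − v_*)·v/|v − v_*| − α₂ |v − v_*|)²} and |k_α(v, v_*)| ≤ C₀ w_γ(|v − v_*|) (1 + |v| + |v_*|)^{γ−1} e^{−α₁ |v − v_*|²} e^{−α₃ ((v − v_*)·v_*/|v − v_*| + α₂ |v − v_*|)²} hold. Then there exists a constant C > 0 such that for every measurable h : ℝ³ → ℝ, ∫_{ℝ³} (∫_{ℝ³} |k_α(v, v_*)| |h(v_*)| dv_*)² (1 + |v|)^{4−γ} dv ≤ C ∫_{ℝ³} h(v)² (1 + |v|)^γ dv. -/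
open MeasureTheory Real Set
open scoped ENNReal RealInnerProductSpace

noncomputable section

/-- `ℝ³` as a Euclidean space. -/
abbrev E3 : Type := EuclideanSpace ℝ (Fin 3)

/-- The singular weight `w_γ`. -/
def wGamma (γ r : ℝ) : ℝ :=
  if -1 < γ then 1 / r
  else if γ = -1 then (|Real.log r| + 1) / r
  else 1 / r ^ |γ|

/-- The substitution `r = √(x² + s²)` for fixed `x`. -/
lemma lintegral_comp_sqrt_add_sq_le (x : ℝ) (g : ℝ → ℝ≥0∞) :
    ∫⁻ s in Ioi (0 : ℝ), ENNReal.ofReal s * g (√(x ^ 2 + s ^ 2)) ≤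
      ∫⁻ r in Ioi (0 : ℝ), (Icc (-r) r).indicator (fun _ => ENNReal.ofReal r * g r) x := by
  have hpos : ∀ s ∈ Ioi (0 : ℝ), 0 < x ^ 2 + s ^ 2 := fun s hs => by
    have : 0 < s := hs
    positivity
  have hderiv : ∀ s ∈ Ioi (0 : ℝ),
      HasDerivWithinAt (fun s : ℝ => √(x ^ 2 + s ^ 2)) (s / √(x ^ 2 + s ^ 2)) (Ioi 0) s := by
    intro s hs
    have h1 : HasDerivAt (fun s : ℝ => x ^ 2 + s ^ 2) (2 * s) s := by
      simpa using (hasDerivAt_pow 2 s).const_add (x ^ 2)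
    have h2 := (h1.sqrt (hpos s hs).ne').hasDerivWithinAt (s := Ioi 0)
    rwa [mul_div_mul_left _ _ two_ne_zero] at h2
  have hinj : InjOn (fun s : ℝ => √(x ^ 2 + s ^ 2)) (Ioi 0) := by
    intro s hs t ht hst
    have := (Real.sqrt_inj (hpos s hs).le (hpos t ht).le).1 hst
    exact (pow_left_inj₀ (le_of_lt hs) (le_of_lt ht) two_ne_zero).1 (by linarith)
  have key := lintegral_image_eq_lintegral_abs_deriv_mul measurableSet_Ioi hderiv hinj
    (fun r => (Icc (-r) r).indicator (fun _ => ENNReal.ofReal r * g r) x)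
  have himage : (fun s : ℝ => √(x ^ 2 + s ^ 2)) '' Ioi 0 ⊆ Ioi 0 := by
    rintro _ ⟨s, hs, rfl⟩
    exact Real.sqrt_pos.2 (hpos s hs)
  refine le_trans (le_of_eq ?_) (lintegral_mono_set himage)
  rw [key]
  refine setLIntegral_congr_fun measurableSet_Ioi fun s hs => ?_
  have hs' : 0 < s := hs
  have hr : 0 < √(x ^ 2 + s ^ 2) := Real.sqrt_pos.2 (hpos s hs)
  have hx : x ∈ Icc (-√(x ^ 2 + s ^ 2)) (√(x ^ 2 + s ^ 2)) :=
    abs_le.1 (Real.abs_le_sqrt (by nlinarith))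
  simp only [indicator_of_mem hx]
  rw [← mul_assoc, ← ENNReal.ofReal_mul (abs_nonneg _), abs_of_pos (by positivity),
    div_mul_cancel₀ _ hr.ne']

/-- Integration over the plane of a radial function. -/
lemma lintegral_radial_plane (g : ℝ → ℝ≥0∞) (hg : Measurable g) :
    ∫⁻ q : ℝ × ℝ, g (q.1 ^ 2 + q.2 ^ 2) =
      ENNReal.ofReal (2 * π) * ∫⁻ s in Ioi (0 : ℝ), ENNReal.ofReal s * g (s ^ 2) := by
  rw [← lintegral_comp_polarCoord_symm]
  have htarget : polarCoord.target = Ioi (0 : ℝ) ×ˢ Ioo (-π) π := rfl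
  have heq : ∀ p : ℝ × ℝ, (polarCoord.symm p).1 ^ 2 + (polarCoord.symm p).2 ^ 2 = p.1 ^ 2 := by
    intro p
    simp only [polarCoord_symm_apply]
    nlinarith [Real.sin_sq_add_cos_sq p.2]
  simp only [heq, htarget, smul_eq_mul]
  rw [Measure.volume_eq_prod, setLIntegral_prod _ (by fun_prop)]
  simp only [lintegral_const, Measure.restrict_apply MeasurableSet.univ, univ_inter,
    Real.volume_Ioo]
  rw [lintegral_mul_const _ (by fun_prop), mul_comm]
  congr 2
  ring

/-- Cylindrical coordinates around the first axis, written in terms of `r = ‖z‖` and `x = z 0`. -/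
lemma lintegral_norm_coord_le (G : ℝ → ℝ → ℝ≥0∞) (hG : Measurable (Function.uncurry G)) :
    ∫⁻ z : E3, G ‖z‖ (z 0) ≤ ENNReal.ofReal (2 * π) *
      ∫⁻ r in Ioi (0 : ℝ), ENNReal.ofReal r * ∫⁻ x in Icc (-r) r, G r x := by
  have hφ : MeasurePreserving (fun z : E3 => (z 0, (z 1, z 2))) volume volume :=
    ((MeasurePreserving.id volume).prod (volume_preserving_finTwoArrow ℝ)).comp
      ((volume_preserving_piFinSuccAbove (fun _ : Fin 3 => ℝ) 0).comp
        (EuclideanSpace.volume_preserving_symm_measurableEquiv_toLp (Fin 3)))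
  have hcomp := hφ.lintegral_comp
    (f := fun p : ℝ × ℝ × ℝ => G (√(p.1 ^ 2 + (p.2.1 ^ 2 + p.2.2 ^ 2))) p.1)
    (hG.comp (by fun_prop : Measurable fun p : ℝ × ℝ × ℝ =>
      (√(p.1 ^ 2 + (p.2.1 ^ 2 + p.2.2 ^ 2)), p.1)))
  have hnorm : ∀ z : E3, ‖z‖ = √(z 0 ^ 2 + (z 1 ^ 2 + z 2 ^ 2)) := by
    intro z
    simp [EuclideanSpace.norm_eq, Fin.sum_univ_three, add_assoc]
  have hGr : ∀ r, Measurable (G r) := fun r => hG.comp measurable_prodMk_left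
  have hind : Measurable (Function.uncurry fun x r : ℝ =>
      (Icc (-r) r).indicator (fun x => ENNReal.ofReal r * G r x) x) := by
    have hset : MeasurableSet {p : ℝ × ℝ | p.1 ∈ Icc (-p.2) p.2} :=
      (measurableSet_le measurable_snd.neg measurable_fst).inter
        (measurableSet_le measurable_fst measurable_snd)
    exact ((show Measurable fun p : ℝ × ℝ => ENNReal.ofReal p.2 by fun_prop).mul
      (hG.comp measurable_swap)).indicator hset
  calc ∫⁻ z : E3, G ‖z‖ (z 0)
      = ∫⁻ p : ℝ × ℝ × ℝ, G (√(p.1 ^ 2 + (p.2.1 ^ 2 + p.2.2 ^ 2))) p.1 := by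
        rw [← hcomp]
        exact lintegral_congr fun z => by rw [hnorm]
    _ = ∫⁻ x : ℝ, ∫⁻ q : ℝ × ℝ, G (√(x ^ 2 + (q.1 ^ 2 + q.2 ^ 2))) x := by
        rw [Measure.volume_eq_prod, lintegral_prod]
        exact (hG.comp (by fun_prop : Measurable fun p : ℝ × ℝ × ℝ =>
          (√(p.1 ^ 2 + (p.2.1 ^ 2 + p.2.2 ^ 2)), p.1))).aemeasurable
    _ = ∫⁻ x : ℝ, ENNReal.ofReal (2 * π) *
          ∫⁻ s in Ioi (0 : ℝ), ENNReal.ofReal s * G (√(x ^ 2 + s ^ 2)) x :=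
        lintegral_congr fun x => lintegral_radial_plane (fun t => G (√(x ^ 2 + t)) x)
          (hG.comp (by fun_prop : Measurable fun t : ℝ => (√(x ^ 2 + t), x)))
    _ ≤ ∫⁻ x : ℝ, ENNReal.ofReal (2 * π) * ∫⁻ r in Ioi (0 : ℝ),
          (Icc (-r) r).indicator (fun x => ENNReal.ofReal r * G r x) x :=
        lintegral_mono fun x => mul_le_mul_right
          (lintegral_comp_sqrt_add_sq_le x (fun r => G r x)) _
    _ = ENNReal.ofReal (2 * π) * ∫⁻ r in Ioi (0 : ℝ), ∫⁻ x : ℝ,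
          (Icc (-r) r).indicator (fun x => ENNReal.ofReal r * G r x) x := by
        rw [lintegral_const_mul _ hind.lintegral_prod_right, lintegral_lintegral_swap]
        exact hind.aemeasurable
    _ = _ := by
        congr 1
        refine lintegral_congr fun r => ?_
        rw [lintegral_indicator measurableSet_Icc, lintegral_const_mul _ (hGr r)]

/-- The angular integral gains one power of `ρ`. -/
lemma setLIntegral_gaussian_le {b : ℝ} (hb : 0 < b) (a : ℝ) {r ρ : ℝ} (hr : 0 < r)
    (hρ : 0 ≤ ρ) :
    ∫⁻ x in Icc (-r) r, ENNReal.ofReal (Real.exp (-b * (ρ * x / r - a * r) ^ 2)) ≤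
      ENNReal.ofReal ((4 + 2 * √(π / b)) / (1 + ρ) * r) := by
  rcases le_total ρ 1 with h | h
  · calc ∫⁻ x in Icc (-r) r, ENNReal.ofReal (Real.exp (-b * (ρ * x / r - a * r) ^ 2))
        ≤ ∫⁻ x in Icc (-r) r, 1 := by
          refine lintegral_mono fun x => ?_
          rw [← ENNReal.ofReal_one]
          refine ENNReal.ofReal_le_ofReal (Real.exp_le_one_iff.2 ?_)
          nlinarith [sq_nonneg (ρ * x / r - a * r)]
      _ = ENNReal.ofReal (2 * r) := by
          rw [setLIntegral_one, Real.volume_Icc]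
          congr 1
          ring
      _ ≤ _ := by
          refine ENNReal.ofReal_le_ofReal (mul_le_mul_of_nonneg_right ?_ hr.le)
          rw [le_div_iff₀ (by positivity)]
          nlinarith [Real.sqrt_nonneg (π / b)]
  · have hρ' : 0 < ρ := by linarith
    have hscale : 0 < ρ / r := by positivity
    have hint : Integrable fun x : ℝ => Real.exp (-b * (ρ * x / r - a * r) ^ 2) := by
      have := ((integrable_exp_neg_mul_sq hb).comp_sub_right (a * r)).comp_mul_left' hscale.ne'
      refine this.congr (ae_of_all _ fun x => ?_)
      simp only
      congr 4
      ring
    have hval : ∫ x : ℝ, Real.exp (-b * (ρ * x / r - a * r) ^ 2) = (ρ / r)⁻¹ * √(π / b) := by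
      have h1 := Measure.integral_comp_mul_left
        (fun y : ℝ => Real.exp (-b * (y - a * r) ^ 2)) (ρ / r)
      rw [integral_sub_right_eq_self (fun y : ℝ => Real.exp (-b * y ^ 2)), integral_gaussian,
        abs_of_pos (by positivity), smul_eq_mul] at h1
      rw [← h1]
      congr 1
      ext x
      congr 4
      ring
    calc ∫⁻ x in Icc (-r) r, ENNReal.ofReal (Real.exp (-b * (ρ * x / r - a * r) ^ 2))
        ≤ ∫⁻ x, ENNReal.ofReal (Real.exp (-b * (ρ * x / r - a * r) ^ 2)) :=
          setLIntegral_le_lintegral _ _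
      _ = ENNReal.ofReal ((ρ / r)⁻¹ * √(π / b)) := by
          rw [← ofReal_integral_eq_lintegral_ofReal hint
            (ae_of_all _ fun x => (Real.exp_pos _).le), hval]
      _ ≤ _ := by
          refine ENNReal.ofReal_le_ofReal ?_
          have hle : √(π / b) / ρ ≤ (4 + 2 * √(π / b)) / (1 + ρ) := by
            rw [div_le_div_iff₀ hρ' (by positivity)]
            nlinarith [Real.sqrt_nonneg (π / b)]
          calc (ρ / r)⁻¹ * √(π / b) = √(π / b) / ρ * r := by rw [inv_div]; ring
            _ ≤ _ := mul_le_mul_of_nonneg_right hle hr.le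

lemma measurable_wGamma (γ : ℝ) : Measurable (wGamma γ) := by
  unfold wGamma
  split_ifs <;> fun_prop

lemma wGamma_nonneg (γ : ℝ) {r : ℝ} (hr : 0 ≤ r) : 0 ≤ wGamma γ r := by
  unfold wGamma
  split_ifs <;> positivity

lemma integrableOn_rpow_mul_one_add_sq_mul_exp {b s : ℝ} (hb : 0 < b) (hs : -1 < s) :
    IntegrableOn (fun r : ℝ => r ^ s * ((1 + r) ^ 2 * Real.exp (-b * r ^ 2))) (Ioi 0) := by
  have h0 := integrableOn_rpow_mul_exp_neg_mul_sq hb hs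
  have h1 := integrableOn_rpow_mul_exp_neg_mul_sq hb (s := s + 1) (by linarith)
  have h2 := integrableOn_rpow_mul_exp_neg_mul_sq hb (s := s + 2) (by linarith)
  refine ((h0.add (h1.const_mul 2)).add h2).congr_fun (fun r hr => ?_) measurableSet_Ioi
  have hr' : 0 < r := hr
  simp only [Pi.add_apply, Real.rpow_add hr', Real.rpow_one, Real.rpow_two]
  ring

lemma abs_log_mul_le_one_add_sq {r : ℝ} (hr : 0 < r) : r * |Real.log r| ≤ 1 + r ^ 2 := by
  have h1 := Real.log_le_sub_one_of_pos hr
  have h2 := Real.log_le_sub_one_of_pos (inv_pos.2 hr)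
  rw [Real.log_inv] at h2
  have h3 : r * r⁻¹ = 1 := mul_inv_cancel₀ hr.ne'
  have h4 : |Real.log r| ≤ r + r⁻¹ := by
    have := inv_pos.2 hr
    rw [abs_le]
    constructor <;> linarith
  nlinarith

/-- The radial weight is integrable against `r² dr`. -/
lemma integrableOn_sq_mul_wGamma {γ b : ℝ} (hγ : -3 < γ) (hb : 0 < b) :
    IntegrableOn (fun r : ℝ => r ^ 2 * (wGamma γ r * (1 + r) ^ 2 * Real.exp (-b * r ^ 2)))
      (Ioi 0) := by
  have hI := fun s (hs : -1 < s) => integrableOn_rpow_mul_one_add_sq_mul_exp hb hs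
  rcases lt_trichotomy (-1) γ with h | h | h
  · refine (hI 1 (by norm_num)).congr_fun (fun r hr => ?_) measurableSet_Ioi
    have hr' : 0 < r := hr
    simp only [wGamma, if_pos h, Real.rpow_one]
    field_simp
  · refine (((hI 0 (by norm_num)).add (hI 1 (by norm_num))).add (hI 2 (by norm_num))).mono'
      (by have := measurable_wGamma γ; fun_prop) ?_
    filter_upwards [ae_restrict_mem measurableSet_Ioi] with r hr
    have hr' : 0 < r := hr
    have hw := wGamma_nonneg γ hr'.le
    have hle : r ^ 2 * wGamma γ r ≤ 1 + r + r ^ 2 := by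
      have hw' : r ^ 2 * wGamma γ r = r * |Real.log r| + r := by
        simp only [wGamma, if_neg h.not_lt, if_pos h.symm]
        field_simp
      rw [hw']
      linarith [abs_log_mul_le_one_add_sq hr']
    rw [Real.norm_of_nonneg (by positivity)]
    simp only [Pi.add_apply, Real.rpow_one, Real.rpow_two, Real.rpow_zero]
    calc _ = r ^ 2 * wGamma γ r * ((1 + r) ^ 2 * Real.exp (-b * r ^ 2)) := by ring
      _ ≤ (1 + r + r ^ 2) * ((1 + r) ^ 2 * Real.exp (-b * r ^ 2)) := by gcongr
      _ = _ := by ring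
  · refine (hI (2 + γ) (by linarith)).congr_fun (fun r hr => ?_) measurableSet_Ioi
    have hr' : 0 < r := hr
    simp only [wGamma, if_neg h.not_gt, if_neg h.ne, abs_of_neg (show γ < 0 by linarith),
      Real.rpow_neg hr'.le, Real.rpow_add hr', Real.rpow_two]
    field_simp

lemma exists_linearIsometryEquiv_smul_eq (u : E3) :
    ∃ L : E3 ≃ₗᵢ[ℝ] E3, L (‖u‖ • EuclideanSpace.single 0 1) = u :=
  ⟨_, Submodule.reflection_sub (by simp [norm_smul])⟩

/-- The Schur integral of the kernel majorant, centred at `u`. -/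
lemma exists_lintegral_majorant_le {γ b c : ℝ} (hγ : -3 < γ) (hb : 0 < b) (hc : 0 < c) (a : ℝ) :
    ∃ M > (0 : ℝ), ∀ u : E3,
      ∫⁻ z : E3, ENNReal.ofReal (wGamma γ ‖z‖ * (1 + ‖z‖) ^ 2 * Real.exp (-b * ‖z‖ ^ 2) *
        Real.exp (-c * (⟪z, u⟫ / ‖z‖ - a * ‖z‖) ^ 2)) ≤ ENNReal.ofReal (M / (1 + ‖u‖)) := by
  set F : ℝ → ℝ := fun r => wGamma γ r * (1 + r) ^ 2 * Real.exp (-b * r ^ 2)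
  have hFm : Measurable F := by have := measurable_wGamma γ; fun_prop
  have hF0 : ∀ r, 0 < r → 0 ≤ F r := fun r hr => by
    have := wGamma_nonneg γ hr.le
    positivity
  have hint : IntegrableOn (fun r => r ^ 2 * F r) (Ioi 0) := integrableOn_sq_mul_wGamma hγ hb
  have hI0 : 0 ≤ ∫ r in Ioi (0 : ℝ), r ^ 2 * F r :=
    setIntegral_nonneg measurableSet_Ioi fun r hr => mul_nonneg (sq_nonneg r) (hF0 r hr)
  set I : ℝ := ∫ r in Ioi (0 : ℝ), r ^ 2 * F r
  set D : ℝ := 4 + 2 * √(π / c)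
  have hD0 : 0 < D := by positivity
  refine ⟨2 * π * (D * (I + 1)), by positivity, fun u => ?_⟩
  obtain ⟨L, hL⟩ := exists_linearIsometryEquiv_smul_eq u
  set ρ : ℝ := ‖u‖
  have hρ0 : 0 ≤ ρ := norm_nonneg u
  have hinner : ∀ z : E3, ⟪L z, u⟫ = ρ * z 0 := by
    intro z
    conv_lhs => rw [← hL, LinearIsometryEquiv.inner_map_map, inner_smul_right]
    simp [EuclideanSpace.inner_single_right]
  have hGm : Measurable (Function.uncurry fun r x : ℝ =>
      ENNReal.ofReal (F r * Real.exp (-c * (ρ * x / r - a * r) ^ 2))) := by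
    simp only [Function.uncurry_def]
    fun_prop
  calc ∫⁻ z : E3, ENNReal.ofReal (F ‖z‖ * Real.exp (-c * (⟪z, u⟫ / ‖z‖ - a * ‖z‖) ^ 2))
      = ∫⁻ z : E3, ENNReal.ofReal (F ‖z‖ * Real.exp (-c * (ρ * z 0 / ‖z‖ - a * ‖z‖) ^ 2)) := by
        rw [← L.measurePreserving.lintegral_comp (by fun_prop)]
        simp only [hinner, LinearIsometryEquiv.norm_map]
    _ ≤ ENNReal.ofReal (2 * π) * ∫⁻ r in Ioi (0 : ℝ), ENNReal.ofReal r * ∫⁻ x in Icc (-r) r,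
          ENNReal.ofReal (F r * Real.exp (-c * (ρ * x / r - a * r) ^ 2)) :=
        lintegral_norm_coord_le _ hGm
    _ ≤ ENNReal.ofReal (2 * π) *
          ∫⁻ r in Ioi (0 : ℝ), ENNReal.ofReal (D / (1 + ρ)) * ENNReal.ofReal (r ^ 2 * F r) := by
        refine mul_le_mul_right (setLIntegral_mono (by fun_prop) fun r hr => ?_) _
        have hr' : 0 < r := hr
        have hFr := hF0 r hr'
        simp only [ENNReal.ofReal_mul hFr]
        rw [lintegral_const_mul _ (by fun_prop)]
        calc _ ≤ ENNReal.ofReal r * (ENNReal.ofReal (F r) * ENNReal.ofReal (D / (1 + ρ) * r)) := by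
              gcongr
              exact setLIntegral_gaussian_le hc a hr' hρ0
          _ = _ := by
              rw [← ENNReal.ofReal_mul hFr, ← ENNReal.ofReal_mul hr'.le,
                ← ENNReal.ofReal_mul (by positivity)]
              congr 1
              ring
    _ = ENNReal.ofReal (2 * π * (D / (1 + ρ) * I)) := by
        rw [lintegral_const_mul _ (by fun_prop), ← ofReal_integral_eq_lintegral_ofReal hint,
          ← ENNReal.ofReal_mul (by positivity), ← ENNReal.ofReal_mul (by positivity)]
        filter_upwards [ae_restrict_mem measurableSet_Ioi] with r hr
        exact mul_nonneg (sq_nonneg r) (hF0 r hr)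
    _ ≤ _ := by
        refine ENNReal.ofReal_le_ofReal ?_
        calc 2 * π * (D / (1 + ρ) * I) ≤ 2 * π * (D / (1 + ρ) * (I + 1)) := by gcongr; linarith
          _ = _ := by ring

/-- Weighted Cauchy–Schwarz inequality. -/
lemma sq_lintegral_mul_le {α : Type*} [MeasurableSpace α] (μ : Measure α) {K H : α → ℝ≥0∞}
    (hK : Measurable K) (hH : Measurable H) :
    (∫⁻ x, K x * H x ∂μ) ^ 2 ≤ (∫⁻ x, K x ∂μ) * ∫⁻ x, K x * H x ^ 2 ∂μ := by
  have hsq : ∀ t : ℝ≥0∞, (t ^ (1 / 2 : ℝ)) ^ 2 = t := fun t => by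
    rw [← ENNReal.rpow_two, ← ENNReal.rpow_mul]
    norm_num
  have h := ENNReal.lintegral_mul_le_Lp_mul_Lq μ Real.HolderConjugate.two_two
    (f := fun x => K x ^ (1 / 2 : ℝ)) (g := fun x => K x ^ (1 / 2 : ℝ) * H x)
    (by fun_prop) (by fun_prop)
  simp only [Pi.mul_apply, ← mul_assoc, ← sq, ENNReal.rpow_two, mul_pow, hsq] at h
  calc (∫⁻ x, K x * H x ∂μ) ^ 2
      ≤ ((∫⁻ x, K x ∂μ) ^ (1 / 2 : ℝ) * (∫⁻ x, K x * H x ^ 2 ∂μ) ^ (1 / 2 : ℝ)) ^ 2 := by gcongr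
    _ = _ := by rw [mul_pow, hsq, hsq]

lemma one_add_norm_sq_le (v vs : E3) :
    (1 + ‖v‖) ^ 2 ≤ (1 + ‖v - vs‖) ^ 2 * (1 + ‖vs‖) ^ 2 := by
  rw [← mul_pow]
  have h := norm_add_le (v - vs) vs
  rw [sub_add_cancel] at h
  gcongr
  nlinarith [norm_nonneg (v - vs), norm_nonneg vs,
    mul_nonneg (norm_nonneg (v - vs)) (norm_nonneg vs)]

/-- Integrals of the kernel against its second variable decay like `(1 + |v|) ^ (γ - 2)`. -/
lemma exists_lintegral_kernel_right_le {γ C₀ α₁ α₂ α₃ : ℝ} (hγl : -3 < γ) (hγu : γ ≤ 1)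
    (hC₀ : 0 < C₀) (hα₁ : 0 < α₁) (hα₃ : 0 < α₃) (kα : E3 → E3 → ℝ)
    (hb1 : ∀ v vs : E3, v ≠ vs →
      |kα v vs| ≤ C₀ * wGamma γ ‖v - vs‖ * (1 + ‖v‖ + ‖vs‖) ^ (γ - 1) *
        Real.exp (-α₁ * ‖v - vs‖ ^ 2) *
        Real.exp (-α₃ * (⟪v - vs, v⟫ / ‖v - vs‖ - α₂ * ‖v - vs‖) ^ 2)) :
    ∃ M > (0 : ℝ), ∀ v : E3, ∫⁻ vs : E3, ENNReal.ofReal |kα v vs| ≤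
      ENNReal.ofReal (M * (1 + ‖v‖) ^ (γ - 2)) := by
  obtain ⟨M, hM, hbound⟩ := exists_lintegral_majorant_le hγl hα₁ hα₃ α₂
  refine ⟨C₀ * M, by positivity, fun v => ?_⟩
  have hv : 0 < 1 + ‖v‖ := by positivity
  calc ∫⁻ vs : E3, ENNReal.ofReal |kα v vs|
      ≤ ∫⁻ vs : E3, ENNReal.ofReal (C₀ * (1 + ‖v‖) ^ (γ - 1)) * ENNReal.ofReal
          (wGamma γ ‖v - vs‖ * (1 + ‖v - vs‖) ^ 2 * Real.exp (-α₁ * ‖v - vs‖ ^ 2) *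
            Real.exp (-α₃ * (⟪v - vs, v⟫ / ‖v - vs‖ - α₂ * ‖v - vs‖) ^ 2)) := by
        refine lintegral_mono_ae ?_
        filter_upwards [compl_mem_ae_iff.2 (measure_singleton v)] with vs hvs
        rw [← ENNReal.ofReal_mul (by positivity)]
        refine ENNReal.ofReal_le_ofReal ((hb1 v vs (Ne.symm hvs)).trans ?_)
        have hw := wGamma_nonneg γ (norm_nonneg (v - vs))
        have h1 : (1 + ‖v‖ + ‖vs‖) ^ (γ - 1) ≤ (1 + ‖v‖) ^ (γ - 1) :=
          Real.rpow_le_rpow_of_nonpos hv (by linarith [norm_nonneg vs]) (by linarith)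
        have h2 : 1 ≤ (1 + ‖v - vs‖) ^ 2 := one_le_pow₀ (by linarith [norm_nonneg (v - vs)])
        calc _ ≤ C₀ * (wGamma γ ‖v - vs‖ * (1 + ‖v - vs‖) ^ 2) * (1 + ‖v‖) ^ (γ - 1) *
              Real.exp (-α₁ * ‖v - vs‖ ^ 2) *
              Real.exp (-α₃ * (⟪v - vs, v⟫ / ‖v - vs‖ - α₂ * ‖v - vs‖) ^ 2) := by
              gcongr
              exact le_mul_of_one_le_right hw h2
          _ = _ := by ring
    _ ≤ ENNReal.ofReal (C₀ * (1 + ‖v‖) ^ (γ - 1)) * ENNReal.ofReal (M / (1 + ‖v‖)) := by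
        rw [lintegral_const_mul _ (by have := measurable_wGamma γ; fun_prop),
          lintegral_sub_left_eq_self (fun z : E3 => ENNReal.ofReal
            (wGamma γ ‖z‖ * (1 + ‖z‖) ^ 2 * Real.exp (-α₁ * ‖z‖ ^ 2) *
              Real.exp (-α₃ * (⟪z, v⟫ / ‖z‖ - α₂ * ‖z‖) ^ 2)))]
        gcongr
        exact hbound v
    _ = _ := by
        rw [← ENNReal.ofReal_mul (by positivity), show γ - 2 = γ - 1 - 1 by ring,
          Real.rpow_sub_one hv.ne' (γ - 1)]
        congr 1
        ring

/-- Weighted integrals of the kernel against its first variable. -/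
lemma exists_lintegral_kernel_left_le {γ C₀ α₁ α₂ α₃ : ℝ} (hγl : -3 < γ) (hγu : γ ≤ 1)
    (hC₀ : 0 < C₀) (hα₁ : 0 < α₁) (hα₃ : 0 < α₃) (kα : E3 → E3 → ℝ)
    (hb2 : ∀ v vs : E3, v ≠ vs →
      |kα v vs| ≤ C₀ * wGamma γ ‖v - vs‖ * (1 + ‖v‖ + ‖vs‖) ^ (γ - 1) *
        Real.exp (-α₁ * ‖v - vs‖ ^ 2) *
        Real.exp (-α₃ * (⟪v - vs, vs⟫ / ‖v - vs‖ + α₂ * ‖v - vs‖) ^ 2)) :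
    ∃ M > (0 : ℝ), ∀ vs : E3, ∫⁻ v : E3, ENNReal.ofReal (|kα v vs| * (1 + ‖v‖) ^ 2) ≤
      ENNReal.ofReal (M * (1 + ‖vs‖) ^ γ) := by
  obtain ⟨M, hM, hbound⟩ := exists_lintegral_majorant_le hγl hα₁ hα₃ (-α₂)
  refine ⟨C₀ * M, by positivity, fun vs => ?_⟩
  have hv : 0 < 1 + ‖vs‖ := by positivity
  calc ∫⁻ v : E3, ENNReal.ofReal (|kα v vs| * (1 + ‖v‖) ^ 2)
      ≤ ∫⁻ v : E3, ENNReal.ofReal (C₀ * ((1 + ‖vs‖) ^ (γ - 1) * (1 + ‖vs‖) ^ 2)) *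
          ENNReal.ofReal
          (wGamma γ ‖v - vs‖ * (1 + ‖v - vs‖) ^ 2 * Real.exp (-α₁ * ‖v - vs‖ ^ 2) *
            Real.exp (-α₃ * (⟪v - vs, vs⟫ / ‖v - vs‖ - -α₂ * ‖v - vs‖) ^ 2)) := by
        refine lintegral_mono_ae ?_
        filter_upwards [compl_mem_ae_iff.2 (measure_singleton vs)] with v hvs
        rw [← ENNReal.ofReal_mul (by positivity)]
        refine ENNReal.ofReal_le_ofReal ?_
        have hw := wGamma_nonneg γ (norm_nonneg (v - vs))
        have h1 : (1 + ‖v‖ + ‖vs‖) ^ (γ - 1) ≤ (1 + ‖vs‖) ^ (γ - 1) :=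
          Real.rpow_le_rpow_of_nonpos hv (by linarith [norm_nonneg v]) (by linarith)
        have hk := hb2 v vs hvs
        rw [← sub_neg_eq_add (⟪v - vs, vs⟫ / ‖v - vs‖), ← neg_mul α₂] at hk
        calc |kα v vs| * (1 + ‖v‖) ^ 2
            ≤ (C₀ * wGamma γ ‖v - vs‖ * (1 + ‖v‖ + ‖vs‖) ^ (γ - 1) *
              Real.exp (-α₁ * ‖v - vs‖ ^ 2) *
              Real.exp (-α₃ * (⟪v - vs, vs⟫ / ‖v - vs‖ - -α₂ * ‖v - vs‖) ^ 2)) *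
              ((1 + ‖v - vs‖) ^ 2 * (1 + ‖vs‖) ^ 2) :=
              mul_le_mul hk (one_add_norm_sq_le v vs) (by positivity) (by positivity)
          _ ≤ (C₀ * wGamma γ ‖v - vs‖ * (1 + ‖vs‖) ^ (γ - 1) *
              Real.exp (-α₁ * ‖v - vs‖ ^ 2) *
              Real.exp (-α₃ * (⟪v - vs, vs⟫ / ‖v - vs‖ - -α₂ * ‖v - vs‖) ^ 2)) *
              ((1 + ‖v - vs‖) ^ 2 * (1 + ‖vs‖) ^ 2) := by gcongr
          _ = _ := by ring
    _ ≤ ENNReal.ofReal (C₀ * ((1 + ‖vs‖) ^ (γ - 1) * (1 + ‖vs‖) ^ 2)) *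
          ENNReal.ofReal (M / (1 + ‖vs‖)) := by
        rw [lintegral_const_mul _ (by have := measurable_wGamma γ; fun_prop),
          lintegral_sub_right_eq_self (fun z : E3 => ENNReal.ofReal
            (wGamma γ ‖z‖ * (1 + ‖z‖) ^ 2 * Real.exp (-α₁ * ‖z‖ ^ 2) *
              Real.exp (-α₃ * (⟪z, vs⟫ / ‖z‖ - -α₂ * ‖z‖) ^ 2)))]
        gcongr
        exact hbound vs
    _ = _ := by
        rw [← ENNReal.ofReal_mul (by positivity), Real.rpow_sub_one hv.ne' γ]
        congr 1
        field_simp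

/-- Boundedness of the integral operator with kernel `|k_α|` from `L²_{0,γ/2}(ℝ³)`
to `L²_{0,(4−γ)/2}(ℝ³)`:
`∫ (∫ |k_α(v,v_*)||h(v_*)| dv_*)² (1+|v|)^{4−γ} dv ≤ C ∫ h² (1+|v|)^γ dv`. -/
theorem kalpha_L2_gain_bounded (γ C₀ α₁ α₂ α₃ : ℝ) (hγl : -3 < γ) (hγu : γ ≤ 1)
    (hC₀ : 0 < C₀) (hα₁ : 0 < α₁) (hα₂ : 0 < α₂) (hα₃ : 0 < α₃)
    (kα : E3 → E3 → ℝ) (hmeas : Measurable (Function.uncurry kα))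
    (hb1 : ∀ v vs : E3, v ≠ vs →
      |kα v vs| ≤ C₀ * wGamma γ ‖v - vs‖ * (1 + ‖v‖ + ‖vs‖) ^ (γ - 1) *
        Real.exp (-α₁ * ‖v - vs‖ ^ 2) *
        Real.exp (-α₃ * (⟪v - vs, v⟫ / ‖v - vs‖ - α₂ * ‖v - vs‖) ^ 2))
    (hb2 : ∀ v vs : E3, v ≠ vs →
      |kα v vs| ≤ C₀ * wGamma γ ‖v - vs‖ * (1 + ‖v‖ + ‖vs‖) ^ (γ - 1) *
        Real.exp (-α₁ * ‖v - vs‖ ^ 2) *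
        Real.exp (-α₃ * (⟪v - vs, vs⟫ / ‖v - vs‖ + α₂ * ‖v - vs‖) ^ 2)) :
    ∃ C > (0 : ℝ), ∀ h : E3 → ℝ, Measurable h →
      ∫⁻ v : E3, (∫⁻ vs : E3, ENNReal.ofReal (|kα v vs| * |h vs|)) ^ 2 *
          ENNReal.ofReal ((1 + ‖v‖) ^ (4 - γ)) ≤
        ENNReal.ofReal C * ∫⁻ v : E3, ENNReal.ofReal (h v ^ 2 * (1 + ‖v‖) ^ γ) := by
  obtain ⟨M₁, hM₁, hrow⟩ := exists_lintegral_kernel_right_le hγl hγu hC₀ hα₁ hα₃ kα hb1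
  obtain ⟨M₂, hM₂, hcol⟩ := exists_lintegral_kernel_left_le hγl hγu hC₀ hα₁ hα₃ kα hb2
  refine ⟨M₁ * M₂, by positivity, fun h hh => ?_⟩
  have hK : Measurable (Function.uncurry fun v vs => ENNReal.ofReal |kα v vs|) :=
    (measurable_norm.comp hmeas).ennreal_ofReal
  have hH : Measurable fun vs => ENNReal.ofReal |h vs| := (measurable_norm.comp hh).ennreal_ofReal
  have hKr : ∀ v, Measurable fun vs => ENNReal.ofReal |kα v vs| :=
    fun v => hK.comp measurable_prodMk_left
  have hweight : Measurable fun p : E3 × E3 =>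
      ENNReal.ofReal ((1 + ‖p.1‖) ^ 2) * (ENNReal.ofReal |kα p.1 p.2| *
        ENNReal.ofReal |h p.2| ^ 2) :=
    (by fun_prop : Measurable fun p : E3 × E3 => ENNReal.ofReal ((1 + ‖p.1‖) ^ 2)).mul
      (hK.mul ((hH.comp measurable_snd).pow_const 2))
  calc ∫⁻ v : E3, (∫⁻ vs : E3, ENNReal.ofReal (|kα v vs| * |h vs|)) ^ 2 *
          ENNReal.ofReal ((1 + ‖v‖) ^ (4 - γ))
      ≤ ∫⁻ v : E3, ENNReal.ofReal M₁ * ∫⁻ vs : E3, ENNReal.ofReal ((1 + ‖v‖) ^ 2) *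
          (ENNReal.ofReal |kα v vs| * ENNReal.ofReal |h vs| ^ 2) := by
        refine lintegral_mono fun v => ?_
        have hv : 0 < 1 + ‖v‖ := by positivity
        have hKH : Measurable fun vs => ENNReal.ofReal |kα v vs| * ENNReal.ofReal |h vs| ^ 2 :=
          (hKr v).mul (hH.pow_const 2)
        simp only [ENNReal.ofReal_mul (abs_nonneg _)]
        rw [lintegral_const_mul _ hKH]
        calc _ ≤ ENNReal.ofReal (M₁ * (1 + ‖v‖) ^ (γ - 2)) *
              (∫⁻ vs : E3, ENNReal.ofReal |kα v vs| * ENNReal.ofReal |h vs| ^ 2) *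
              ENNReal.ofReal ((1 + ‖v‖) ^ (4 - γ)) := by
              gcongr
              exact (sq_lintegral_mul_le volume (hKr v) hH).trans (mul_le_mul_left (hrow v) _)
          _ = ENNReal.ofReal (M₁ * (1 + ‖v‖) ^ (γ - 2)) * ENNReal.ofReal ((1 + ‖v‖) ^ (4 - γ)) *
              ∫⁻ vs : E3, ENNReal.ofReal |kα v vs| * ENNReal.ofReal |h vs| ^ 2 := by ring
          _ = _ := by
              rw [← ENNReal.ofReal_mul (by positivity), mul_assoc, ← Real.rpow_add hv,
                show γ - 2 + (4 - γ) = 2 by ring, Real.rpow_two, ENNReal.ofReal_mul hM₁.le,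
                mul_assoc]
    _ = ENNReal.ofReal M₁ * ∫⁻ vs : E3, ∫⁻ v : E3, ENNReal.ofReal ((1 + ‖v‖) ^ 2) *
          (ENNReal.ofReal |kα v vs| * ENNReal.ofReal |h vs| ^ 2) := by
        rw [lintegral_const_mul _ hweight.lintegral_prod_right',
          lintegral_lintegral_swap hweight.aemeasurable]
    _ ≤ ENNReal.ofReal M₁ *
          ∫⁻ vs : E3, ENNReal.ofReal M₂ * ENNReal.ofReal (h vs ^ 2 * (1 + ‖vs‖) ^ γ) := by
        gcongr with vs
        calc ∫⁻ v : E3, ENNReal.ofReal ((1 + ‖v‖) ^ 2) *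
              (ENNReal.ofReal |kα v vs| * ENNReal.ofReal |h vs| ^ 2)
            = ∫⁻ v : E3, ENNReal.ofReal |h vs| ^ 2 *
                ENNReal.ofReal (|kα v vs| * (1 + ‖v‖) ^ 2) := by
              refine lintegral_congr fun v => ?_
              rw [ENNReal.ofReal_mul (abs_nonneg _)]
              ring
          _ ≤ ENNReal.ofReal |h vs| ^ 2 * ENNReal.ofReal (M₂ * (1 + ‖vs‖) ^ γ) := by
              rw [lintegral_const_mul']
              · gcongr
                exact hcol vs
              · exact ENNReal.pow_ne_top ENNReal.ofReal_ne_top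
          _ = _ := by
              rw [← ENNReal.ofReal_pow (abs_nonneg _), sq_abs,
                ← ENNReal.ofReal_mul (sq_nonneg _), ← ENNReal.ofReal_mul hM₂.le]
              congr 1
              ring
    _ = _ := by
        rw [lintegral_const_mul _ (by fun_prop), ENNReal.ofReal_mul hM₁.le, mul_assoc]
end
end

section
/- Let Ω ⊆ ℝ³ be a bounded open set, B₀ > 0 and −3 < γ ≤ 1, and let ν(v) = B₀ π ∫_{ℝ³} |v − w|^γ e^{−|w|²} dw be the collision frequency. Then there exists a constant C > 0 such that for all x ∈ Ω and all v ∈ ℝ³, ∫₀^{τ₋(x,v)} e^{−ν(v) t} dt ≤ C / (1 + |v|). -/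
open MeasureTheory Real Set
open scoped ENNReal

noncomputable section

/-- The collision frequency `ν(v) = B₀ π ∫_{ℝ³} |v − w|^γ e^{−|w|²} dw`. -/
def nu (B₀ γ : ℝ) (v : E3) : ℝ :=
  B₀ * π * ∫ w : E3, ‖v - w‖ ^ γ * Real.exp (-‖w‖ ^ 2)

/-- The backward exit time `τ₋(x, v) = inf {t > 0 : x − t v ∉ Ω}` (equal to `+∞` if
no such `t` exists). -/
def tauMinus (Ω : Set E3) (x v : E3) : ℝ≥0∞ :=
  sInf (ENNReal.ofReal '' {t : ℝ | 0 < t ∧ x - t • v ∉ Ω})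

/-- The interval of integration `(0, τ₋(x,v))`. -/
def tauItv (Ω : Set E3) (x v : E3) : Set ℝ :=
  {t : ℝ | 0 < t ∧ ENNReal.ofReal t < tauMinus Ω x v}

/-- A negative power of the norm above the critical exponent is integrable on the unit ball. -/
lemma integrableOn_ball_norm_rpow {γ : ℝ} (hγ : -3 < γ) :
    IntegrableOn (fun w : E3 => ‖w‖ ^ γ) (Metric.ball 0 1) := by
  refine integrableOn_ball_of_norm_le_rpow (C := 1) (α := -γ) (by simp) (by simp; linarith)
    (Filter.Eventually.of_forall fun w => ?_) (by fun_prop : Measurable _).aestronglyMeasurable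
  rw [neg_neg, one_mul, Real.norm_of_nonneg (by positivity)]

/-- Polynomial weights are integrable against the Gaussian on `ℝ³`. -/
lemma integrable_norm_pow_mul_exp_neg_sq (k : ℕ) :
    Integrable (fun w : E3 => ‖w‖ ^ k * Real.exp (-‖w‖ ^ 2)) := by
  rw [integrable_fun_norm_addHaar (volume : Measure E3)
    (f := fun y : ℝ => y ^ k * Real.exp (-y ^ 2))]
  refine (integrable_rpow_mul_exp_neg_mul_sq one_pos
    (s := ((2 + k : ℕ) : ℝ)) (by linarith [Nat.cast_nonneg (α := ℝ) (2 + k)])).integrableOn.congr_fun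
    (fun y _ => ?_) measurableSet_Ioi
  simp [pow_add, mul_assoc, -Nat.cast_add, Real.rpow_natCast]

lemma integrable_nu_integrand {γ : ℝ} (hγl : -3 < γ) (hγu : γ ≤ 1) (v : E3) :
    Integrable (fun w : E3 => ‖v - w‖ ^ γ * Real.exp (-‖w‖ ^ 2)) := by
  have hball : Integrable ((Metric.ball (0 : E3) 1).indicator fun w => ‖w‖ ^ γ) :=
    (integrableOn_ball_norm_rpow hγl).integrable_indicator Metric.isOpen_ball.measurableSet
  refine Integrable.mono' ((hball.comp_sub_left v).add
    (((integrable_norm_pow_mul_exp_neg_sq 0).const_mul ‖v‖).add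
      (integrable_norm_pow_mul_exp_neg_sq 1)))
    (by fun_prop : Measurable _).aestronglyMeasurable (Filter.Eventually.of_forall fun w => ?_)
  rw [Real.norm_of_nonneg (by positivity)]
  simp only [Pi.add_apply, pow_zero, one_mul, pow_one]
  by_cases h : ‖v - w‖ < 1
  · rw [indicator_of_mem (by simpa using h)]
    have : Real.exp (-‖w‖ ^ 2) ≤ 1 := Real.exp_le_one_iff.2 (by simp)
    have := mul_le_mul_of_nonneg_left this (by positivity : 0 ≤ ‖v - w‖ ^ γ)
    have : 0 ≤ ‖v‖ * Real.exp (-‖w‖ ^ 2) + ‖w‖ * Real.exp (-‖w‖ ^ 2) := by positivity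
    linarith
  · rw [indicator_of_notMem (by simpa using h), zero_add, ← add_mul]
    gcongr
    calc ‖v - w‖ ^ γ ≤ ‖v - w‖ ^ (1 : ℝ) := Real.rpow_le_rpow_of_exponent_le (not_lt.1 h) hγu
      _ = ‖v - w‖ := Real.rpow_one _
      _ ≤ ‖v‖ + ‖w‖ := norm_sub_le v w

lemma nu_nonneg {B₀ γ : ℝ} (hB₀ : 0 < B₀) (v : E3) : 0 ≤ nu B₀ γ v :=
  mul_nonneg (by positivity) (integral_nonneg fun _ => by positivity)

/-- The collision frequency is bounded below on the closed unit ball. -/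
lemma exists_pos_le_nu {B₀ γ : ℝ} (hB₀ : 0 < B₀) (hγl : -3 < γ) (hγu : γ ≤ 1) :
    ∃ c > 0, ∀ v : E3, ‖v‖ ≤ 1 → c ≤ nu B₀ γ v := by
  set p : E3 := EuclideanSpace.single 0 3
  have hp : ‖p‖ = 3 := by simp [p]
  have hvol : 0 < (volume : Measure E3).real (Metric.ball p 1) :=
    ENNReal.toReal_pos (Metric.measure_ball_pos _ _ one_pos).ne' measure_ball_lt_top.ne
  refine ⟨B₀ * π * ((5 : ℝ) ^ (-3 : ℝ) * Real.exp (-4 ^ 2) *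
    (volume : Measure E3).real (Metric.ball p 1)), by positivity, fun v hv => ?_⟩
  have hint := integrable_nu_integrand hγl hγu v
  refine mul_le_mul_of_nonneg_left ?_ (by positivity)
  refine le_trans ?_ (setIntegral_le_integral (s := Metric.ball p 1) hint
    (Filter.Eventually.of_forall fun _ => by positivity))
  refine setIntegral_ge_of_const_le_real Metric.isOpen_ball.measurableSet measure_ball_lt_top.ne
    (fun w hw => ?_) hint.integrableOn
  rw [mem_ball_iff_norm] at hw
  have hw_lower : 2 ≤ ‖w‖ := by linarith [norm_sub_norm_le p w, norm_sub_rev p w]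
  have hw_upper : ‖w‖ ≤ 4 := by linarith [norm_sub_norm_le w p]
  have h_one : 1 ≤ ‖v - w‖ := by linarith [norm_sub_norm_le w v, norm_sub_rev w v]
  have h_five : ‖v - w‖ ≤ 5 := by linarith [norm_sub_le v w]
  gcongr
  calc (5 : ℝ) ^ (-3 : ℝ) ≤ ‖v - w‖ ^ (-3 : ℝ) :=
        Real.rpow_le_rpow_of_nonpos (by linarith) h_five (by norm_num)
    _ ≤ ‖v - w‖ ^ γ := Real.rpow_le_rpow_of_exponent_le h_one hγl.le

lemma mul_norm_le_of_mem_tauItv {Ω : Set E3} {r : ℝ} (hΩ : ∀ x ∈ Ω, ‖x‖ ≤ r) {x v : E3}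
    (hx : x ∈ Ω) {t : ℝ} (ht : t ∈ tauItv Ω x v) : t * ‖v‖ ≤ 2 * r := by
  have hmem : x - t • v ∈ Ω := by
    by_contra h
    exact (sInf_le (mem_image_of_mem ENNReal.ofReal
      (show t ∈ {s : ℝ | 0 < s ∧ x - s • v ∉ Ω} from ⟨ht.1, h⟩))).not_gt ht.2
  have := norm_sub_le x (x - t • v)
  rw [sub_sub_cancel, norm_smul, Real.norm_of_nonneg ht.1.le] at this
  linarith [hΩ _ hx, hΩ _ hmem]

lemma lintegral_exp_neg_mul_Ioi {a : ℝ} (ha : 0 < a) :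
    ∫⁻ t in Ioi (0 : ℝ), ENNReal.ofReal (Real.exp (-a * t)) = ENNReal.ofReal (1 / a) := by
  rw [← ofReal_integral_eq_lintegral_ofReal (integrableOn_exp_mul_Ioi (neg_lt_zero.2 ha) 0)
    (Filter.Eventually.of_forall fun _ => (Real.exp_pos _).le),
    integral_exp_mul_Ioi (neg_lt_zero.2 ha)]
  simp

/-- For a bounded open set `Ω`, `∫₀^{τ₋(x,v)} e^{−ν(v)t} dt ≤ C / (1 + |v|)`. -/
theorem exit_time_exp_integral_bound (Ω : Set E3) (hΩo : IsOpen Ω)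
    (hΩb : Bornology.IsBounded Ω) (B₀ γ : ℝ) (hB₀ : 0 < B₀) (hγl : -3 < γ) (hγu : γ ≤ 1) :
    ∃ C > (0 : ℝ), ∀ x ∈ Ω, ∀ v : E3,
      ∫⁻ t in tauItv Ω x v, ENNReal.ofReal (Real.exp (-(nu B₀ γ v) * t)) ≤
        ENNReal.ofReal (C / (1 + ‖v‖)) := by
  obtain ⟨r, hr, hΩ⟩ := hΩb.exists_pos_norm_le
  obtain ⟨c, hc, hnu⟩ := exists_pos_le_nu hB₀ hγl hγu
  refine ⟨4 * r + 2 / c, by positivity, fun x hx v => ?_⟩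
  rcases le_total ‖v‖ 1 with hv | hv
  · have hpos := hc.trans_le (hnu v hv)
    refine (lintegral_mono_set fun t ht => ht.1).trans
      ((lintegral_exp_neg_mul_Ioi hpos).trans_le (ENNReal.ofReal_le_ofReal ?_))
    calc 1 / nu B₀ γ v ≤ 1 / c := one_div_le_one_div_of_le hc (hnu v hv)
      _ = (2 / c) / 2 := by ring
      _ ≤ (4 * r + 2 / c) / (1 + ‖v‖) := by
        gcongr
        · linarith
        · linarith
  · have hv_pos : 0 < ‖v‖ := one_pos.trans_le hv
    have hsub : tauItv Ω x v ⊆ Ioc 0 (2 * r / ‖v‖) := fun t ht =>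
      ⟨ht.1, (le_div_iff₀ hv_pos).2 (mul_norm_le_of_mem_tauItv hΩ hx ht)⟩
    calc ∫⁻ t in tauItv Ω x v, ENNReal.ofReal (Real.exp (-(nu B₀ γ v) * t))
        ≤ ∫⁻ t in Ioc 0 (2 * r / ‖v‖), ENNReal.ofReal (Real.exp (-(nu B₀ γ v) * t)) :=
          lintegral_mono_set hsub
      _ ≤ ∫⁻ _ in Ioc 0 (2 * r / ‖v‖), 1 := by
          refine setLIntegral_mono measurable_const fun t ht => ENNReal.ofReal_le_one.2 ?_
          rw [Real.exp_le_one_iff, neg_mul]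
          exact neg_nonpos.2 (mul_nonneg (nu_nonneg hB₀ v) ht.1.le)
      _ = ENNReal.ofReal (2 * r / ‖v‖) := by simp
      _ ≤ ENNReal.ofReal ((4 * r + 2 / c) / (1 + ‖v‖)) := by
          refine ENNReal.ofReal_le_ofReal ?_
          rw [div_le_div_iff₀ hv_pos (by positivity)]
          have : 0 ≤ 2 / c * ‖v‖ := by positivity
          nlinarith
end
end

section
/- Let −3 < γ ≤ 1, B₀ > 0, and let ν be the collision frequency. Define s_{2,γ} = 1/2 for −2 < γ ≤ 1 and s_{2,γ} = (3+γ)/2 for −3 < γ < −2; for γ = −2 fix any 0 < ε < 1/2 and set s_{2,γ} = 1/2 − ε. Let k_α : ℝ³ × ℝ³ → ℝ be a measurable kernel for which there exist constants C₀ > 0 and α₁, α₂, α₃ > 0 such that for all v ≠ v_*, both |k_α(v, v_*)| ≤ C₀ w_γ(|v − v_*|) (1 + |v| + |v_*|)^{γ−1} e^{−α₁ |v − v_*|²} and |k_α(v, v_*)| ≤ C₀ w_γ(|v − v_*|) (1 + |v| + |v_*|)^{γ−1} e^{−α₁ |v − v_*|²} e^{−α₃ ((v − v_*)·v_*/|v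 − v_*| + α₂ |v − v_*|)²} hold. Then there exists a constant C > 0 (depending also on ε when γ = −2) such that for all ξ ∈ ℝ³ and all v_* ∈ ℝ³, ∫_{ℝ³} |k_α(v, v_*)| (1 + |v|)^{2γ−1} / (ν(v)² + (v·ξ)²) dv ≤ C (1 + |ξ|²)^{−s_{2,γ}} (1 + |v_*|)^γ. -/
open MeasureTheory Real Set
open scoped ENNReal RealInnerProductSpace

noncomputable section

/-- The smoothing exponent `s_{2,γ}`: `1/2` for `−2 < γ ≤ 1`, `1/2 − ε` for `γ = −2`,
and `(3+γ)/2` for `−3 < γ < −2`. -/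
def sTwoGamma (γ ε : ℝ) : ℝ :=
  if -2 < γ then 1 / 2 else if γ = -2 then 1 / 2 - ε else (3 + γ) / 2

lemma integrable_norm_rpow_mul_exp_neg_mul_sq {E : Type*} [NormedAddCommGroup E]
    [NormedSpace ℝ E] [Nontrivial E] [FiniteDimensional ℝ E] [MeasureSpace E] [BorelSpace E]
    [(volume : Measure E).IsAddHaarMeasure] {s c : ℝ}
    (hs : -(Module.finrank ℝ E : ℝ) < s) (hc : 0 < c) :
    Integrable fun x : E => ‖x‖ ^ s * Real.exp (-c * ‖x‖ ^ 2) := by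
  have hd : 1 ≤ Module.finrank ℝ E := Module.finrank_pos
  refine (integrable_fun_norm_addHaar volume
    (f := fun r : ℝ => r ^ s * Real.exp (-c * r ^ 2))).2 ?_
  have h := integrableOn_rpow_mul_exp_neg_mul_sq hc
    (s := s + ((Module.finrank ℝ E : ℝ) - 1)) (by linarith)
  refine h.congr_fun (fun r hr => ?_) measurableSet_Ioi
  have hr' : (0 : ℝ) < r := hr
  simp only [smul_eq_mul]
  rw [Real.rpow_add hr', ← Nat.cast_one, ← Nat.cast_sub hd, Real.rpow_natCast]
  ring

lemma lintegral_comp_const_mul (f : ℝ → ℝ≥0∞) {a : ℝ} (ha : a ≠ 0) :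
    ∫⁻ x, f (a * x) = ENNReal.ofReal |a⁻¹| * ∫⁻ x, f x := by
  have h := (Homeomorph.mulLeft₀ a ha).measurableEmbedding.lintegral_map (μ := volume) f
  simp only [Homeomorph.coe_mulLeft₀] at h
  rw [← h, Real.map_volume_mul_left ha, lintegral_smul_measure, smul_eq_mul]

lemma lintegral_abs_rpow_div_one_add_sq_le {q : ℝ} (hq : 0 < q) (hq1 : q ≤ 1) :
    ∃ K : ℝ, 0 < K ∧ ∀ a : ℝ,
      ∫⁻ t : ℝ, ENNReal.ofReal (|t| ^ (q - 1) / (1 + (t + a) ^ 2)) ≤ ENNReal.ofReal K := by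
  have h1 : Integrable fun t : ℝ => ‖t‖ ^ (q - 1) * Real.exp (-1 * ‖t‖ ^ 2) :=
    integrable_norm_rpow_mul_exp_neg_mul_sq (by simp; linarith) one_pos
  have h2 := integrable_inv_one_add_sq
  refine ⟨Real.exp 1 * (∫ t : ℝ, ‖t‖ ^ (q - 1) * Real.exp (-1 * ‖t‖ ^ 2)) + π,
    by positivity, fun a => ?_⟩
  have h3 : Integrable fun t : ℝ => (1 + (t + a) ^ 2)⁻¹ := h2.comp_add_right a
  have h4 : Integrable fun t : ℝ => Real.exp 1 * (‖t‖ ^ (q - 1) * Real.exp (-1 * ‖t‖ ^ 2)) +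
      (1 + (t + a) ^ 2)⁻¹ := (h1.const_mul (Real.exp 1)).add h3
  have h5 : Real.exp 1 * (∫ t : ℝ, ‖t‖ ^ (q - 1) * Real.exp (-1 * ‖t‖ ^ 2)) + π =
      ∫ t : ℝ, (Real.exp 1 * (‖t‖ ^ (q - 1) * Real.exp (-1 * ‖t‖ ^ 2)) +
        (1 + (t + a) ^ 2)⁻¹) := by
    rw [integral_add (h1.const_mul _) h3, integral_const_mul,
      integral_add_right_eq_self (fun t : ℝ => (1 + t ^ 2)⁻¹), integral_univ_inv_one_add_sq]
  rw [h5, ofReal_integral_eq_lintegral_ofReal h4 (Filter.Eventually.of_forall fun t => by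
    simp only [Pi.zero_apply]; positivity)]
  refine lintegral_mono fun t => ENNReal.ofReal_le_ofReal ?_
  rw [← Real.norm_eq_abs]
  rcases le_or_gt ‖t‖ 1 with h | h
  · have : 1 ≤ Real.exp 1 * Real.exp (-1 * ‖t‖ ^ 2) := by
      rw [← Real.exp_add]
      apply Real.one_le_exp
      nlinarith [norm_nonneg t]
    have hn : 0 ≤ ‖t‖ ^ (q - 1) := by positivity
    calc ‖t‖ ^ (q - 1) / (1 + (t + a) ^ 2) ≤ ‖t‖ ^ (q - 1) :=
          div_le_self hn (by nlinarith [sq_nonneg (t + a)])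
      _ ≤ ‖t‖ ^ (q - 1) * (Real.exp 1 * Real.exp (-1 * ‖t‖ ^ 2)) :=
          le_mul_of_one_le_right hn this
      _ ≤ _ := by
        have : 0 ≤ (1 + (t + a) ^ 2)⁻¹ := by positivity
        linarith
  · have : ‖t‖ ^ (q - 1) ≤ 1 := Real.rpow_le_one_of_one_le_of_nonpos h.le (by linarith)
    have h6 : 0 ≤ Real.exp 1 * (‖t‖ ^ (q - 1) * Real.exp (-1 * ‖t‖ ^ 2)) := by positivity
    have h7 : ‖t‖ ^ (q - 1) / (1 + (t + a) ^ 2) ≤ 1 / (1 + (t + a) ^ 2) := by gcongr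
    rw [one_div] at h7
    linarith

lemma lintegral_abs_rpow_div_sq_add_sq_le {q : ℝ} (hq : 0 < q) (hq1 : q ≤ 1) :
    ∃ K : ℝ, 0 < K ∧ ∀ n X a : ℝ, 0 < n → 0 < X →
      ∫⁻ t : ℝ, ENNReal.ofReal (|t| ^ (q - 1) / (n ^ 2 + (X * t + a) ^ 2)) ≤
        ENNReal.ofReal (K * n ^ (q - 2) * X ^ (-q)) := by
  obtain ⟨K, hK, h⟩ := lintegral_abs_rpow_div_one_add_sq_le hq hq1
  refine ⟨K, hK, fun n X a hn hX => ?_⟩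
  have hm : 0 < X / n := by positivity
  have key : ∀ t : ℝ, ENNReal.ofReal (|t| ^ (q - 1) / (n ^ 2 + (X * t + a) ^ 2)) =
      ENNReal.ofReal ((X / n) ^ (1 - q) / n ^ 2) *
        ENNReal.ofReal (|X / n * t| ^ (q - 1) / (1 + (X / n * t + a / n) ^ 2)) := by
    intro t
    rw [← ENNReal.ofReal_mul (by positivity)]
    congr 1
    have e1 : n ^ 2 + (X * t + a) ^ 2 = n ^ 2 * (1 + (X / n * t + a / n) ^ 2) := by
      field_simp
    have e2 : (X / n) ^ (1 - q) * |X / n * t| ^ (q - 1) = |t| ^ (q - 1) := by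
      rw [abs_mul, abs_of_pos hm, Real.mul_rpow hm.le (abs_nonneg t), ← mul_assoc,
        ← Real.rpow_add hm]
      simp
    rw [e1, ← e2]
    field_simp
  simp_rw [key]
  rw [lintegral_const_mul' _ _ ENNReal.ofReal_ne_top,
    lintegral_comp_const_mul (fun s => ENNReal.ofReal (|s| ^ (q - 1) / (1 + (s + a / n) ^ 2)))
      hm.ne']
  refine (mul_le_mul_right (mul_le_mul_right (h (a / n)) _) _).trans ?_
  rw [← ENNReal.ofReal_mul (by positivity), ← ENNReal.ofReal_mul (by positivity)]
  apply ENNReal.ofReal_le_ofReal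
  apply le_of_eq
  rw [abs_of_pos (by positivity), Real.div_rpow hX.le hn.le, Real.rpow_sub hX,
    Real.rpow_sub hn, Real.rpow_sub hn, Real.rpow_neg hX.le, Real.rpow_one, Real.rpow_one,
    Real.rpow_two]
  field_simp

lemma lintegral_sq_add_sq_rpow_mul_exp_le {β q c : ℝ} (hc : 0 < c) (hβ : 0 < β)
    (h : (q = 1 ∧ β < 2) ∨ (β = 3 - q ∧ q < 1)) :
    ∃ A : ℝ, 0 < A ∧ ∀ t : ℝ, t ≠ 0 →
      ∫⁻ y : ℝ, ENNReal.ofReal ((t ^ 2 + y ^ 2) ^ (-(β / 4)) * Real.exp (-c * y ^ 2)) ≤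
        ENNReal.ofReal (A * |t| ^ ((q - 1) / 2)) := by
  rcases h with ⟨rfl, hβ2⟩ | ⟨rfl, hq⟩
  · have h1 : Integrable fun y : ℝ => ‖y‖ ^ (-(β / 2)) * Real.exp (-c * ‖y‖ ^ 2) :=
      integrable_norm_rpow_mul_exp_neg_mul_sq (by simp; linarith) hc
    refine ⟨1 + ∫ y : ℝ, ‖y‖ ^ (-(β / 2)) * Real.exp (-c * ‖y‖ ^ 2), by positivity,
      fun t ht => ?_⟩
    calc _ ≤ ∫⁻ y : ℝ, ENNReal.ofReal (‖y‖ ^ (-(β / 2)) * Real.exp (-c * ‖y‖ ^ 2)) := by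
          refine lintegral_mono_ae ?_
          filter_upwards [Measure.ae_ne volume (0 : ℝ)] with y hy
          apply ENNReal.ofReal_le_ofReal
          rw [Real.norm_eq_abs, sq_abs]
          gcongr
          have hy' : 0 < |y| := abs_pos.2 hy
          have : |y| ^ (-(β / 2)) = (|y| ^ 2) ^ (-(β / 4)) := by
            rw [← Real.rpow_two, ← Real.rpow_mul hy'.le]; ring_nf
          rw [this, sq_abs]
          exact Real.rpow_le_rpow_of_nonpos (by positivity) (by nlinarith [sq_nonneg t])
            (by linarith)
      _ = ENNReal.ofReal (∫ y : ℝ, ‖y‖ ^ (-(β / 2)) * Real.exp (-c * ‖y‖ ^ 2)) := by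
          rw [ofReal_integral_eq_lintegral_ofReal h1
            (Filter.Eventually.of_forall fun t => by simp only [Pi.zero_apply]; positivity)]
      _ ≤ _ := by
          apply ENNReal.ofReal_le_ofReal
          simp
  · have h1 : Integrable fun y : ℝ => (1 + ‖y‖ ^ 2) ^ (-((3 - q) / 2) / 2) :=
      integrable_rpow_neg_one_add_norm_sq (by simp; linarith)
    refine ⟨1 + ∫ y : ℝ, (1 + ‖y‖ ^ 2) ^ (-((3 - q) / 2) / 2), by positivity, fun t ht => ?_⟩
    have ht' : 0 < |t| := abs_pos.2 ht
    have key : ∀ y : ℝ, (t ^ 2 + y ^ 2) ^ (-((3 - q) / 4)) =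
        |t| ^ (-((3 - q) / 2)) * (1 + ‖t⁻¹ * y‖ ^ 2) ^ (-((3 - q) / 2) / 2) := by
      intro y
      have e1 : t ^ 2 + y ^ 2 = |t| ^ 2 * (1 + ‖t⁻¹ * y‖ ^ 2) := by
        rw [Real.norm_eq_abs, sq_abs, sq_abs]; field_simp
      rw [e1, Real.mul_rpow (by positivity) (by positivity), ← Real.rpow_two,
        ← Real.rpow_mul ht'.le]
      ring_nf
    calc _ ≤ ∫⁻ y : ℝ, ENNReal.ofReal (|t| ^ (-((3 - q) / 2))) *
            ENNReal.ofReal ((1 + ‖t⁻¹ * y‖ ^ 2) ^ (-((3 - q) / 2) / 2)) := by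
          refine lintegral_mono fun y => ?_
          rw [← ENNReal.ofReal_mul (by positivity), ← key]
          apply ENNReal.ofReal_le_ofReal
          apply mul_le_of_le_one_right (by positivity)
          apply Real.exp_le_one_iff.2
          nlinarith [sq_nonneg y]
      _ = ENNReal.ofReal (|t| ^ (-((3 - q) / 2)) * (|t| *
            ∫ y : ℝ, (1 + ‖y‖ ^ 2) ^ (-((3 - q) / 2) / 2))) := by
          rw [lintegral_const_mul' _ _ ENNReal.ofReal_ne_top, lintegral_comp_const_mul
            (fun y => ENNReal.ofReal ((1 + ‖y‖ ^ 2) ^ (-((3 - q) / 2) / 2))) (inv_ne_zero ht),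
            ← ofReal_integral_eq_lintegral_ofReal h1
            (Filter.Eventually.of_forall fun t => by simp only [Pi.zero_apply]; positivity),
            ← ENNReal.ofReal_mul (by positivity), ← ENNReal.ofReal_mul (by positivity), inv_inv]
      _ ≤ _ := by
          apply ENNReal.ofReal_le_ofReal
          have e2 : |t| ^ ((q - 1) / 2) = |t| ^ (-((3 - q) / 2)) * |t| := by
            nth_rewrite 3 [← Real.rpow_one |t|]
            rw [← Real.rpow_add ht']
            ring_nf
          rw [e2, ← mul_assoc, mul_comm]
          gcongr
          linarith

lemma lintegral_fin_three_le (H : (Fin 3 → ℝ) → ℝ≥0∞) :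
    ∫⁻ x, H x ≤ ∫⁻ t : ℝ, ∫⁻ y : ℝ, ∫⁻ z : ℝ, H ![t, y, z] := by
  have h3 := (volume_preserving_piFinSuccAbove (fun _ : Fin 3 => ℝ) 0).symm
  have h2 := (volume_preserving_piFinTwo (fun _ : Fin 2 => ℝ)).symm
  rw [← h3.lintegral_comp_emb (MeasurableEquiv.measurableEmbedding _)]
  refine (lintegral_prod_le _).trans (lintegral_mono fun t => ?_)
  rw [← h2.lintegral_comp_emb (MeasurableEquiv.measurableEmbedding _)]
  refine (lintegral_prod_le _).trans (lintegral_mono fun y => lintegral_mono fun z => ?_)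
  apply le_of_eq
  congr 1
  ext i
  fin_cases i <;> rfl

lemma lintegral_eq_lintegral_coords {ξ : E3} (hξ : ξ ≠ 0) (F : ℝ → ℝ → ℝ≥0∞) :
    ∫⁻ u : E3, F (‖u‖ ^ 2) ⟪u, ξ⟫ =
      ∫⁻ x : Fin 3 → ℝ, F (x 0 ^ 2 + x 1 ^ 2 + x 2 ^ 2) (‖ξ‖ * x 0) := by
  have hX : ‖ξ‖ ≠ 0 := norm_ne_zero_iff.2 hξ
  obtain ⟨b, hb⟩ := Orthonormal.exists_orthonormalBasis_extension_of_card_eq (𝕜 := ℝ) (E := E3)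
    (ι := Fin 3) (by simp) (v := fun _ => (‖ξ‖⁻¹ : ℝ) • ξ) (s := {0}) (by
      constructor
      · intro i
        simp [norm_smul, hX]
      · intro i j hij
        exact (hij (Subsingleton.elim _ _)).elim)
  have hb0 : b 0 = (‖ξ‖⁻¹ : ℝ) • ξ := hb 0 rfl
  have hp := (PiLp.volume_preserving_ofLp (Fin 3)).comp b.measurePreserving_repr
  have he : MeasurableEmbedding ((@WithLp.ofLp 2 (Fin 3 → ℝ)) ∘ b.repr) :=
    (MeasurableEquiv.toLp 2 (Fin 3 → ℝ)).symm.measurableEmbedding.comp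
      b.repr.toHomeomorph.measurableEmbedding
  rw [← hp.lintegral_comp_emb he]
  refine lintegral_congr fun u => ?_
  congr 1
  · rw [← b.repr.norm_map u, EuclideanSpace.norm_sq_eq, Fin.sum_univ_three]
    simp [sq_abs]
  · simp only [Function.comp_apply, b.repr_apply_apply, hb0, real_inner_smul_left]
    rw [real_inner_comm u ξ]
    field_simp

lemma rpow_neg_add_sq_le {β t : ℝ} (hβ : 0 < β) (ht : t ≠ 0) (y z : ℝ) :
    (t ^ 2 + y ^ 2 + z ^ 2) ^ (-(β / 2)) ≤
      (t ^ 2 + y ^ 2) ^ (-(β / 4)) * (t ^ 2 + z ^ 2) ^ (-(β / 4)) := by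
  have ht2 : 0 < t ^ 2 := by positivity
  have e : (t ^ 2 + y ^ 2 + z ^ 2) ^ (-(β / 2)) =
      (t ^ 2 + y ^ 2 + z ^ 2) ^ (-(β / 4)) * (t ^ 2 + y ^ 2 + z ^ 2) ^ (-(β / 4)) := by
    rw [← Real.rpow_add (by positivity)]
    ring_nf
  rw [e]
  apply mul_le_mul _ _ (by positivity) (by positivity)
  · exact Real.rpow_le_rpow_of_nonpos (by positivity) (by nlinarith [sq_nonneg z]) (by linarith)
  · exact Real.rpow_le_rpow_of_nonpos (by positivity) (by nlinarith [sq_nonneg y]) (by linarith)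

lemma lintegral_norm_rpow_mul_exp_div_le {β q c : ℝ} (hc : 0 < c) (hβ : 0 < β) (hβ3 : β < 3)
    (hq : 0 < q) (hq1 : q ≤ 1) (h : (q = 1 ∧ β < 2) ∨ (β = 3 - q ∧ q < 1)) :
    ∃ K : ℝ, 0 < K ∧ ∀ (n a : ℝ) (ξ : E3), 0 < n →
      (∫⁻ u : E3, ENNReal.ofReal
        (‖u‖ ^ (-β) * Real.exp (-c * ‖u‖ ^ 2) / (n ^ 2 + (⟪u, ξ⟫ + a) ^ 2)) ≤
          ENNReal.ofReal (K * n ^ (-2 : ℝ))) ∧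
      (ξ ≠ 0 → ∫⁻ u : E3, ENNReal.ofReal
        (‖u‖ ^ (-β) * Real.exp (-c * ‖u‖ ^ 2) / (n ^ 2 + (⟪u, ξ⟫ + a) ^ 2)) ≤
          ENNReal.ofReal (K * n ^ (q - 2) * ‖ξ‖ ^ (-q))) := by
  have hI : Integrable fun u : E3 => ‖u‖ ^ (-β) * Real.exp (-c * ‖u‖ ^ 2) :=
    integrable_norm_rpow_mul_exp_neg_mul_sq (by simp; linarith) hc
  obtain ⟨A, hA, hA'⟩ := lintegral_sq_add_sq_rpow_mul_exp_le hc hβ h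
  obtain ⟨L, hL, hL'⟩ := lintegral_abs_rpow_div_sq_add_sq_le hq hq1
  set I := ∫ u : E3, ‖u‖ ^ (-β) * Real.exp (-c * ‖u‖ ^ 2) with hIdef
  have hI0 : 0 ≤ I := by positivity
  refine ⟨I + A ^ 2 * L, by positivity, fun n a ξ hn => ⟨?_, fun hξ => ?_⟩⟩
  · calc _ ≤ ∫⁻ u : E3, ENNReal.ofReal (n ^ (-2 : ℝ)) *
          ENNReal.ofReal (‖u‖ ^ (-β) * Real.exp (-c * ‖u‖ ^ 2)) := by
          refine lintegral_mono fun u => ?_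
          rw [← ENNReal.ofReal_mul (by positivity)]
          apply ENNReal.ofReal_le_ofReal
          rw [Real.rpow_neg hn.le, Real.rpow_two, div_eq_inv_mul]
          gcongr
          nlinarith [sq_nonneg (⟪u, ξ⟫ + a)]
      _ = ENNReal.ofReal (n ^ (-2 : ℝ) * I) := by
          rw [lintegral_const_mul' _ _ ENNReal.ofReal_ne_top,
            ← ofReal_integral_eq_lintegral_ofReal hI
            (Filter.Eventually.of_forall fun t => by simp only [Pi.zero_apply]; positivity),
            ← ENNReal.ofReal_mul (by positivity)]
      _ ≤ _ := by
          apply ENNReal.ofReal_le_ofReal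
          rw [mul_comm]
          gcongr
          nlinarith [sq_nonneg A]
  · have hX : 0 < ‖ξ‖ := norm_pos_iff.2 hξ
    have e1 : ∀ u : E3, ‖u‖ ^ (-β) = (‖u‖ ^ 2) ^ (-(β / 2)) := by
      intro u
      rw [← Real.rpow_two, ← Real.rpow_mul (norm_nonneg u)]
      ring_nf
    simp_rw [e1]
    rw [lintegral_eq_lintegral_coords hξ (fun s x => ENNReal.ofReal
      (s ^ (-(β / 2)) * Real.exp (-c * s) / (n ^ 2 + (x + a) ^ 2)))]
    refine (lintegral_fin_three_le _).trans ?_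
    set g : ℝ → ℝ → ℝ := fun t y => (t ^ 2 + y ^ 2) ^ (-(β / 4)) * Real.exp (-c * y ^ 2) with hg
    have hg0 : ∀ t y, 0 ≤ g t y := fun t y => by positivity
    have hmain : ∀ t : ℝ, t ≠ 0 →
        ∫⁻ y : ℝ, ∫⁻ z : ℝ, ENNReal.ofReal ((t ^ 2 + y ^ 2 + z ^ 2) ^ (-(β / 2)) *
          Real.exp (-c * (t ^ 2 + y ^ 2 + z ^ 2)) / (n ^ 2 + (‖ξ‖ * t + a) ^ 2)) ≤
        ENNReal.ofReal (A ^ 2) *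
          ENNReal.ofReal (|t| ^ (q - 1) / (n ^ 2 + (‖ξ‖ * t + a) ^ 2)) := by
      intro t ht
      have ht' : 0 < |t| := abs_pos.2 ht
      set D := (n ^ 2 + (‖ξ‖ * t + a) ^ 2)⁻¹ with hD
      have hD0 : 0 ≤ D := by positivity
      have hy := hA' t ht
      calc _ ≤ ∫⁻ y : ℝ, ∫⁻ z : ℝ, ENNReal.ofReal D * ENNReal.ofReal (g t y) *
            ENNReal.ofReal (g t z) := by
            refine lintegral_mono fun y => lintegral_mono fun z => ?_
            rw [← ENNReal.ofReal_mul hD0,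
              ← ENNReal.ofReal_mul (mul_nonneg hD0 (hg0 t y))]
            apply ENNReal.ofReal_le_ofReal
            rw [div_eq_inv_mul, mul_assoc]
            apply mul_le_mul_of_nonneg_left _ hD0
            have h1 := rpow_neg_add_sq_le hβ ht y z
            have h2 : Real.exp (-c * (t ^ 2 + y ^ 2 + z ^ 2)) ≤
                Real.exp (-c * y ^ 2) * Real.exp (-c * z ^ 2) := by
              rw [← Real.exp_add]
              apply Real.exp_le_exp.2
              nlinarith [sq_nonneg t]
            calc _ ≤ ((t ^ 2 + y ^ 2) ^ (-(β / 4)) * (t ^ 2 + z ^ 2) ^ (-(β / 4))) *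
                  (Real.exp (-c * y ^ 2) * Real.exp (-c * z ^ 2)) := by gcongr
              _ = g t y * g t z := by simp only [hg]; ring
        _ = ENNReal.ofReal D * ((∫⁻ y : ℝ, ENNReal.ofReal (g t y)) *
              ∫⁻ z : ℝ, ENNReal.ofReal (g t z)) := by
            have hfin : ∫⁻ z : ℝ, ENNReal.ofReal (g t z) ≠ ∞ :=
              (hy.trans_lt ENNReal.ofReal_lt_top).ne
            have hz : ∀ y : ℝ, ∫⁻ z : ℝ, ENNReal.ofReal D * ENNReal.ofReal (g t y) *
                ENNReal.ofReal (g t z) = ENNReal.ofReal D * (ENNReal.ofReal (g t y) *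
                  ∫⁻ z : ℝ, ENNReal.ofReal (g t z)) := fun y => by
              rw [lintegral_const_mul' _ _
                (ENNReal.mul_ne_top ENNReal.ofReal_ne_top ENNReal.ofReal_ne_top), mul_assoc]
            rw [lintegral_congr hz, lintegral_const_mul' _ _ ENNReal.ofReal_ne_top, lintegral_mul_const' _ _ hfin]
        _ ≤ ENNReal.ofReal D * (ENNReal.ofReal (A * |t| ^ ((q - 1) / 2)) *
              ENNReal.ofReal (A * |t| ^ ((q - 1) / 2))) := by
            gcongr
        _ = _ := by
            rw [← ENNReal.ofReal_mul (by positivity), ← ENNReal.ofReal_mul (by positivity),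
              ← ENNReal.ofReal_mul (by positivity)]
            congr 1
            have e2 : |t| ^ (q - 1) = |t| ^ ((q - 1) / 2) * |t| ^ ((q - 1) / 2) := by
              rw [← Real.rpow_add ht']
              ring_nf
            rw [e2, hD]
            ring
    calc _ ≤ ∫⁻ t : ℝ, ENNReal.ofReal (A ^ 2) *
          ENNReal.ofReal (|t| ^ (q - 1) / (n ^ 2 + (‖ξ‖ * t + a) ^ 2)) := by
          refine lintegral_mono_ae ?_
          filter_upwards [Measure.ae_ne volume (0 : ℝ)] with t ht
          exact hmain t ht
      _ = ENNReal.ofReal (A ^ 2) *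
          ∫⁻ t : ℝ, ENNReal.ofReal (|t| ^ (q - 1) / (n ^ 2 + (‖ξ‖ * t + a) ^ 2)) :=
          lintegral_const_mul' _ _ ENNReal.ofReal_ne_top
      _ ≤ ENNReal.ofReal (A ^ 2) * ENNReal.ofReal (L * n ^ (q - 2) * ‖ξ‖ ^ (-q)) := by
          gcongr
          exact hL' n ‖ξ‖ a hn hX
      _ ≤ _ := by
          rw [← ENNReal.ofReal_mul (by positivity)]
          apply ENNReal.ofReal_le_ofReal
          have : 0 ≤ n ^ (q - 2) * ‖ξ‖ ^ (-q) := by positivity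
          nlinarith [mul_nonneg hI0 this]

lemma integrable_norm_sub_rpow_mul_exp {γ : ℝ} (hγl : -3 < γ) (hγu : γ ≤ 1) (v : E3) :
    Integrable fun w : E3 => ‖v - w‖ ^ γ * Real.exp (-‖w‖ ^ 2) := by
  have h0 : Integrable fun w : E3 => ‖w‖ ^ (0 : ℝ) * Real.exp (-1 * ‖w‖ ^ 2) :=
    integrable_norm_rpow_mul_exp_neg_mul_sq (by simp) one_pos
  have h1 : Integrable fun w : E3 => ‖w‖ ^ (1 : ℝ) * Real.exp (-1 * ‖w‖ ^ 2) :=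
    integrable_norm_rpow_mul_exp_neg_mul_sq (by simp; linarith) one_pos
  have h2 : Integrable fun w : E3 => ‖w‖ ^ γ * Real.exp (-1 * ‖w‖ ^ 2) :=
    integrable_norm_rpow_mul_exp_neg_mul_sq (by simp; linarith) one_pos
  have h3 := (((h2.comp_sub_left v).const_mul (Real.exp 1)).add
    (h0.const_mul (1 + ‖v‖))).add h1
  refine h3.mono' ?_ (Filter.Eventually.of_forall fun w => ?_)
  · apply Measurable.aestronglyMeasurable
    fun_prop
  · rw [Real.norm_of_nonneg (by positivity)]
    simp only [Pi.add_apply, Real.rpow_zero, Real.rpow_one, one_mul, neg_mul]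
    have hE := Real.exp_pos (-‖w‖ ^ 2)
    have hvw : ‖v - w‖ ≤ ‖v‖ + ‖w‖ := norm_sub_le v w
    rcases le_or_gt ‖v - w‖ 1 with h | h
    · have h4 : 1 ≤ Real.exp 1 * Real.exp (-‖v - w‖ ^ 2) := by
        rw [← Real.exp_add]
        apply Real.one_le_exp
        nlinarith [norm_nonneg (v - w)]
      have h5 : Real.exp (-‖w‖ ^ 2) ≤ 1 := Real.exp_le_one_iff.2 (by nlinarith [norm_nonneg w])
      have h6 : 0 ≤ ‖v - w‖ ^ γ := by positivity
      have h7 : ‖v - w‖ ^ γ * Real.exp (-‖w‖ ^ 2) ≤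
          Real.exp 1 * (‖v - w‖ ^ γ * Real.exp (-‖v - w‖ ^ 2)) := by
        calc _ ≤ ‖v - w‖ ^ γ * (Real.exp 1 * Real.exp (-‖v - w‖ ^ 2)) := by
              gcongr; exact h5.trans h4
          _ = _ := by ring
      have : 0 ≤ (1 + ‖v‖) * Real.exp (-‖w‖ ^ 2) + ‖w‖ * Real.exp (-‖w‖ ^ 2) := by positivity
      linarith
    · have h4 : ‖v - w‖ ^ γ ≤ ‖v - w‖ := by
        calc _ ≤ ‖v - w‖ ^ (1 : ℝ) := Real.rpow_le_rpow_of_exponent_le h.le hγu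
          _ = _ := Real.rpow_one _
      have h5 : ‖v - w‖ ^ γ * Real.exp (-‖w‖ ^ 2) ≤
          (‖v‖ + ‖w‖) * Real.exp (-‖w‖ ^ 2) := by
        gcongr; exact h4.trans hvw
      have : 0 ≤ Real.exp 1 * (‖v - w‖ ^ γ * Real.exp (-‖v - w‖ ^ 2)) := by positivity
      linarith

lemma one_add_norm_rpow_le {γ : ℝ} (v w : E3) (h1 : 1 ≤ ‖w‖) (h2 : ‖w‖ ≤ 2) :
    (2 : ℝ) ^ (-|γ|) * (1 + ‖v‖) ^ γ ≤ ‖v - w‖ ^ γ + ‖v + w‖ ^ γ := by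
  have ha : ‖v - w‖ ≤ ‖v‖ + ‖w‖ := norm_sub_le v w
  have hb : ‖v + w‖ ≤ ‖v‖ + ‖w‖ := norm_add_le v w
  have hv : 2 * ‖v‖ ≤ ‖v - w‖ + ‖v + w‖ := by
    have := norm_add_le (v - w) (v + w)
    rwa [show v - w + (v + w) = (2 : ℝ) • v by rw [two_smul]; abel, norm_smul,
      Real.norm_of_nonneg zero_le_two] at this
  have hw : 2 * ‖w‖ ≤ ‖v - w‖ + ‖v + w‖ := by
    have := norm_sub_le (v + w) (v - w)
    rw [show v + w - (v - w) = (2 : ℝ) • w by rw [two_smul]; abel, norm_smul,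
      Real.norm_of_nonneg zero_le_two] at this
    linarith
  have hv0 := norm_nonneg v
  have key : ∀ x : ℝ, 0 < x → (1 + ‖v‖) / 2 ≤ x → x ≤ 2 * (1 + ‖v‖) →
      (2 : ℝ) ^ (-|γ|) * (1 + ‖v‖) ^ γ ≤ x ^ γ := by
    intro x hx hl hu
    rcases le_total 0 γ with h | h
    · rw [abs_of_nonneg h]
      calc (2 : ℝ) ^ (-γ) * (1 + ‖v‖) ^ γ = ((1 + ‖v‖) / 2) ^ γ := by
            rw [Real.div_rpow (by positivity) zero_le_two, Real.rpow_neg zero_le_two]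
            field_simp
        _ ≤ _ := Real.rpow_le_rpow (by positivity) hl h
    · rw [abs_of_nonpos h, neg_neg, ← Real.mul_rpow zero_le_two (by positivity)]
      exact Real.rpow_le_rpow_of_nonpos hx hu h
  rcases le_total ‖v - w‖ ‖v + w‖ with h | h
  · have := key ‖v + w‖ (by linarith) (by linarith) (by linarith)
    have h0 : 0 ≤ ‖v - w‖ ^ γ := by positivity
    linarith
  · have := key ‖v - w‖ (by linarith) (by linarith) (by linarith)
    have h0 : 0 ≤ ‖v + w‖ ^ γ := by positivity
    linarith

lemma exists_le_nu {B₀ γ : ℝ} (hγl : -3 < γ) (hγu : γ ≤ 1) (hB₀ : 0 < B₀) :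
    ∃ c : ℝ, 0 < c ∧ c ≤ 1 ∧ ∀ v : E3, c * (1 + ‖v‖) ^ γ ≤ nu B₀ γ v := by
  let S : Set E3 := Metric.ball (EuclideanSpace.single 0 (3 / 2)) (1 / 2)
  have hS : MeasurableSet S := Metric.isOpen_ball.measurableSet
  have hSpos : 0 < volume.real S :=
    ENNReal.toReal_pos (Metric.measure_ball_pos _ _ (by norm_num)).ne' measure_ball_lt_top.ne
  have hSn : ∀ w ∈ S, 1 ≤ ‖w‖ ∧ ‖w‖ ≤ 2 := by
    intro w hw
    have h1 : ‖w - EuclideanSpace.single 0 (3 / 2 : ℝ)‖ < 1 / 2 := by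
      rw [← dist_eq_norm]; exact hw
    have h2 : ‖(EuclideanSpace.single 0 (3 / 2 : ℝ) : E3)‖ = 3 / 2 := by
      simp
    have h3 := abs_norm_sub_norm_le w (EuclideanSpace.single 0 (3 / 2 : ℝ))
    rw [h2] at h3
    have h4 := abs_le.1 (h3.trans h1.le)
    constructor <;> linarith [h4.1, h4.2]
  set c₁ : ℝ := B₀ * π * (2 : ℝ) ^ (-|γ|) * Real.exp (-4) * volume.real S / 2 with hc₁
  have hc₁pos : 0 < c₁ := by positivity
  refine ⟨min c₁ 1, by positivity, min_le_right _ _, fun v => ?_⟩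
  have hf := integrable_norm_sub_rpow_mul_exp hγl hγu v
  have hfn : Integrable fun w : E3 => ‖v + w‖ ^ γ * Real.exp (-‖w‖ ^ 2) := by
    simpa using hf.comp_neg
  have heq : ∫ w : E3, ‖v + w‖ ^ γ * Real.exp (-‖w‖ ^ 2) =
      ∫ w : E3, ‖v - w‖ ^ γ * Real.exp (-‖w‖ ^ 2) := by
    rw [← integral_neg_eq_self (fun w : E3 => ‖v - w‖ ^ γ * Real.exp (-‖w‖ ^ 2))]
    simp
  have hsum : 2 * ∫ w : E3, ‖v - w‖ ^ γ * Real.exp (-‖w‖ ^ 2) =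
      ∫ w : E3, (‖v - w‖ ^ γ * Real.exp (-‖w‖ ^ 2) + ‖v + w‖ ^ γ * Real.exp (-‖w‖ ^ 2)) := by
    rw [integral_add hf hfn, heq, two_mul]
  have hlow : ((2 : ℝ) ^ (-|γ|) * (1 + ‖v‖) ^ γ * Real.exp (-4)) * volume.real S ≤
      2 * ∫ w : E3, ‖v - w‖ ^ γ * Real.exp (-‖w‖ ^ 2) := by
    rw [hsum]
    refine (setIntegral_ge_of_const_le_real hS measure_ball_lt_top.ne (fun w hw => ?_)
      (hf.add hfn).integrableOn).trans
      (setIntegral_le_integral (hf.add hfn) (Filter.Eventually.of_forall fun w => ?_))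
    · obtain ⟨h1, h2⟩ := hSn w hw
      simp only [Pi.add_apply]
      rw [← add_mul]
      have := one_add_norm_rpow_le (γ := γ) v w h1 h2
      gcongr
      nlinarith
    · simp only [Pi.zero_apply, Pi.add_apply]
      positivity
  calc min c₁ 1 * (1 + ‖v‖) ^ γ ≤ c₁ * (1 + ‖v‖) ^ γ := by
        gcongr; exact min_le_left _ _
    _ = B₀ * π * (((2 : ℝ) ^ (-|γ|) * (1 + ‖v‖) ^ γ * Real.exp (-4)) * volume.real S / 2) := by
        rw [hc₁]; ring
    _ ≤ _ := by
        rw [nu]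
        gcongr
        linarith

lemma abs_log_add_one_div_le {r : ℝ} (hr : 0 < r) :
    (|Real.log r| + 1) / r ≤ 3 * r ^ (-(3 / 2) : ℝ) * (1 + r) := by
  obtain ⟨s, hs, rfl⟩ : ∃ s : ℝ, 0 < s ∧ r = s ^ 2 :=
    ⟨√r, Real.sqrt_pos.2 hr, (Real.sq_sqrt hr.le).symm⟩
  have h1 : (s ^ 2) ^ (-(3 / 2) : ℝ) = (s ^ 3)⁻¹ := by
    rw [← Real.rpow_natCast s 2, ← Real.rpow_mul hs.le, ← Real.rpow_natCast s 3,
      ← Real.rpow_neg hs.le]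
    norm_num
  have h2 : |Real.log (s ^ 2)| ≤ 2 * (s + s⁻¹) := by
    rw [Real.log_pow]
    have h3 := Real.log_le_sub_one_of_pos hs
    have h4 := Real.log_le_sub_one_of_pos (inv_pos.2 hs)
    rw [Real.log_inv] at h4
    have h5 := inv_pos.2 hs
    rw [abs_le]
    constructor <;> push_cast <;> linarith
  rw [h1]
  calc _ ≤ (2 * (s + s⁻¹) + 1) / s ^ 2 := by gcongr
    _ = (2 * s ^ 2 + 2 + s) / s ^ 3 := by field_simp
    _ ≤ (3 * (1 + s ^ 2)) / s ^ 3 := by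
        gcongr
        nlinarith [sq_nonneg (s - 1)]
    _ = _ := by field_simp

lemma exists_wGamma_le {γ ε : ℝ} (hγl : -3 < γ) (hε : γ = -2 → 0 < ε ∧ ε < 1 / 2) :
    ∃ β q C : ℝ, 0 < β ∧ β < 3 ∧ 0 < q ∧ q ≤ 1 ∧ q = 2 * sTwoGamma γ ε ∧
      ((q = 1 ∧ β < 2) ∨ (β = 3 - q ∧ q < 1)) ∧ 0 < C ∧
      ∀ r : ℝ, 0 < r → wGamma γ r ≤ C * r ^ (-β) * (1 + r) := by
  have habs : γ < 0 → ∀ r : ℝ, 0 < r → 1 / r ^ |γ| ≤ 1 * r ^ (-(-γ)) * (1 + r) := by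
    intro hγ r hr
    rw [abs_of_neg hγ, one_div, ← Real.rpow_neg hr.le, one_mul]
    exact le_mul_of_one_le_right (by positivity) (by linarith)
  by_cases h1 : -1 < γ
  · refine ⟨1, 1, 1, by norm_num, by norm_num, by norm_num, by norm_num, ?_,
      Or.inl ⟨rfl, by norm_num⟩, one_pos, fun r hr => ?_⟩
    · rw [sTwoGamma, if_pos (by linarith)]; norm_num
    · rw [wGamma, if_pos h1, Real.rpow_neg hr.le, Real.rpow_one, one_div, one_mul]
      exact le_mul_of_one_le_right (by positivity) (by linarith)
  by_cases h2 : γ = -1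
  · refine ⟨3 / 2, 1, 3, by norm_num, by norm_num, by norm_num, by norm_num, ?_,
      Or.inl ⟨rfl, by norm_num⟩, by norm_num, fun r hr => ?_⟩
    · rw [sTwoGamma, if_pos (by linarith)]; norm_num
    · rw [wGamma, if_neg h1, if_pos h2]
      exact abs_log_add_one_div_le hr
  have h1' : γ < -1 := lt_of_le_of_ne (not_lt.1 h1) h2
  rcases lt_trichotomy γ (-2) with h3 | h3 | h3
  · refine ⟨-γ, 3 + γ, 1, by linarith, by linarith, by linarith, by linarith, ?_,
      Or.inr ⟨by ring, by linarith⟩, one_pos, fun r hr => ?_⟩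
    · rw [sTwoGamma, if_neg (by linarith), if_neg h3.ne]; ring
    · rw [wGamma, if_neg h1, if_neg h2]
      exact habs (by linarith) r hr
  · obtain ⟨hε0, hε1⟩ := hε h3
    refine ⟨2 + 2 * ε, 1 - 2 * ε, 1, by linarith, by linarith, by linarith, by linarith, ?_,
      Or.inr ⟨by ring, by linarith⟩, one_pos, fun r hr => ?_⟩
    · rw [sTwoGamma, if_neg (by linarith), if_pos h3]; ring
    · rw [wGamma, if_neg h1, if_neg h2]
      have h4 : r ^ (2 * ε) ≤ 1 + r := by
        rcases le_or_gt r 1 with h | h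
        · linarith [Real.rpow_le_one hr.le h (by linarith : 0 ≤ 2 * ε)]
        · have := Real.rpow_le_rpow_of_exponent_le h.le (by linarith : 2 * ε ≤ 1)
          rw [Real.rpow_one] at this
          linarith
      calc 1 / r ^ |γ| = 1 * r ^ (-(2 + 2 * ε)) * r ^ (2 * ε) := by
            rw [abs_of_neg (by linarith), h3, one_div, ← Real.rpow_neg hr.le, one_mul,
              ← Real.rpow_add hr]
            ring_nf
        _ ≤ _ := by gcongr
  · refine ⟨-γ, 1, 1, by linarith, by linarith, by norm_num, by norm_num, ?_,
      Or.inl ⟨rfl, by linarith⟩, one_pos, fun r hr => ?_⟩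
    · rw [sTwoGamma, if_pos h3]; norm_num
    · rw [wGamma, if_neg h1, if_neg h2]
      exact habs (by linarith) r hr

lemma one_add_norm_rpow_le_mul {E : Type*} [NormedAddCommGroup E] (p : ℝ) (v w : E) :
    (1 + ‖v‖) ^ p ≤ (1 + ‖w‖) ^ p * (1 + ‖v - w‖) ^ |p| := by
  have hv := norm_nonneg v
  have hw := norm_nonneg w
  have hr := norm_nonneg (v - w)
  have h1 : ‖v‖ ≤ ‖w‖ + ‖v - w‖ := by
    have := norm_add_le w (v - w)
    rwa [add_sub_cancel] at this
  have h2 : ‖w‖ ≤ ‖v‖ + ‖v - w‖ := by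
    have := norm_sub_le v (v - w)
    rwa [sub_sub_cancel] at this
  rcases le_total 0 p with h | h
  · rw [abs_of_nonneg h, ← Real.mul_rpow (by positivity) (by positivity)]
    exact Real.rpow_le_rpow (by positivity) (by nlinarith) h
  · rw [abs_of_nonpos h, Real.rpow_neg (by positivity), ← div_eq_mul_inv,
      ← Real.div_rpow (by positivity) (by positivity)]
    refine Real.rpow_le_rpow_of_nonpos (by positivity) ?_ h
    rw [div_le_iff₀ (by positivity)]
    nlinarith

lemma one_add_rpow_mul_exp_le {N α r : ℝ} (hN : 0 ≤ N) (hα : 0 < α) (hr : 0 ≤ r) :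
    (1 + r) ^ N * Real.exp (-α * r ^ 2) ≤
      Real.exp (N ^ 2 / (2 * α)) * Real.exp (-(α / 2) * r ^ 2) := by
  have h1 : (1 + r) ^ N ≤ Real.exp (N * r) := by
    rw [mul_comm, Real.exp_mul]
    exact Real.rpow_le_rpow (by positivity) (by linarith [Real.add_one_le_exp r]) hN
  calc _ ≤ Real.exp (N * r) * Real.exp (-α * r ^ 2) := by gcongr
    _ ≤ _ := by
      rw [← Real.exp_add, ← Real.exp_add]
      apply Real.exp_le_exp.2
      have : N ^ 2 / (2 * α) - N * r + α / 2 * r ^ 2 = (N - α * r) ^ 2 / (2 * α) := by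
        field_simp
        ring
      have h2 : 0 ≤ (N - α * r) ^ 2 / (2 * α) := by positivity
      linarith

lemma div_nu_sq_add_sq_le {γ c ν x : ℝ} (hc : 0 < c) (hc1 : c ≤ 1) (v w : E3)
    (hν : c * (1 + ‖v‖) ^ γ ≤ ν) :
    1 / (ν ^ 2 + x ^ 2) ≤
      (1 + ‖v - w‖) ^ (2 * |γ|) / c ^ 2 * (1 / (((1 + ‖w‖) ^ γ) ^ 2 + x ^ 2)) := by
  have hr := norm_nonneg (v - w)
  have hP := one_add_norm_rpow_le_mul γ w v
  rw [norm_sub_rev] at hP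
  set R := (1 + ‖v - w‖) ^ |γ| with hR
  have hR1 : 1 ≤ R := Real.one_le_rpow (by linarith) (abs_nonneg γ)
  have hR2 : (1 + ‖v - w‖) ^ (2 * |γ|) = R ^ 2 := by
    rw [hR, mul_comm, Real.rpow_mul (by positivity), Real.rpow_two]
  have hv : 0 < (1 + ‖v‖) ^ γ := by positivity
  have hw : 0 < (1 + ‖w‖) ^ γ := by positivity
  have hν0 : 0 < ν := lt_of_lt_of_le (by positivity) hν
  rw [hR2, div_mul_div_comm, mul_one, div_le_div_iff₀ (by positivity) (by positivity), one_mul]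
  have h1 : c * (1 + ‖w‖) ^ γ ≤ R * ν := by nlinarith
  have h2 : (c * (1 + ‖w‖) ^ γ) ^ 2 ≤ (R * ν) ^ 2 := by gcongr
  have h3 : c ^ 2 * x ^ 2 ≤ R ^ 2 * x ^ 2 := by gcongr; linarith
  nlinarith

lemma rpow_neg_le_two_mul {s x : ℝ} (hs0 : 0 < s) (hs1 : s ≤ 1) (hx : 0 ≤ x) :
    (x ≤ 1 → 1 ≤ 2 * (1 + x ^ 2) ^ (-s)) ∧ (1 < x → x ^ (-(2 * s)) ≤ 2 * (1 + x ^ 2) ^ (-s)) := by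
  have h2 : (2 : ℝ) ^ s ≤ 2 := by
    simpa using Real.rpow_le_rpow_of_exponent_le one_le_two hs1
  have hp : 0 < (1 + x ^ 2) ^ s := by positivity
  rw [Real.rpow_neg (by positivity), ← div_eq_mul_inv]
  constructor
  · intro h
    rw [le_div_iff₀ hp, one_mul]
    refine le_trans (Real.rpow_le_rpow (by positivity) ?_ hs0.le) h2
    nlinarith
  · intro h
    have hx0 : 0 < x := by linarith
    have hxs : 0 < x ^ (2 * s) := by positivity
    have h3 : (1 + x ^ 2) ^ s ≤ 2 * x ^ (2 * s) := by
      calc _ ≤ (2 * x ^ 2) ^ s := Real.rpow_le_rpow (by positivity) (by nlinarith) hs0.le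
        _ = 2 ^ s * x ^ (2 * s) := by
            rw [Real.mul_rpow zero_le_two (by positivity), Real.rpow_mul hx0.le, Real.rpow_two]
        _ ≤ _ := by gcongr
    rw [Real.rpow_neg hx0.le, inv_le_iff_one_le_mul₀ hxs, div_mul_eq_mul_div, le_div_iff₀ hp]
    linarith

/-- The key Fourier-multiplier estimate underlying the velocity averaging lemma:
`∫ |k_α(v,v_*)| (1+|v|)^{2γ−1} / (ν(v)² + (v·ξ)²) dv
  ≤ C (1+|ξ|²)^{−s_{2,γ}} (1+|v_*|)^γ`. -/
theorem velocity_averaging_multiplier_estimate (γ B₀ ε C₀ α₁ α₂ α₃ : ℝ)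
    (hγl : -3 < γ) (hγu : γ ≤ 1) (hB₀ : 0 < B₀)
    (hε : γ = -2 → 0 < ε ∧ ε < 1 / 2)
    (hC₀ : 0 < C₀) (hα₁ : 0 < α₁) (hα₂ : 0 < α₂) (hα₃ : 0 < α₃)
    (kα : E3 → E3 → ℝ) (hmeas : Measurable (Function.uncurry kα))
    (hb1 : ∀ v vs : E3, v ≠ vs →
      |kα v vs| ≤ C₀ * wGamma γ ‖v - vs‖ * (1 + ‖v‖ + ‖vs‖) ^ (γ - 1) *
        Real.exp (-α₁ * ‖v - vs‖ ^ 2))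
    (hb2 : ∀ v vs : E3, v ≠ vs →
      |kα v vs| ≤ C₀ * wGamma γ ‖v - vs‖ * (1 + ‖v‖ + ‖vs‖) ^ (γ - 1) *
        Real.exp (-α₁ * ‖v - vs‖ ^ 2) *
        Real.exp (-α₃ * (⟪v - vs, vs⟫ / ‖v - vs‖ + α₂ * ‖v - vs‖) ^ 2)) :
    ∃ C > (0 : ℝ), ∀ ξ vs : E3,
      ∫⁻ v : E3, ENNReal.ofReal
          (|kα v vs| * (1 + ‖v‖) ^ (2 * γ - 1) / (nu B₀ γ v ^ 2 + ⟪v, ξ⟫ ^ 2)) ≤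
        ENNReal.ofReal (C * (1 + ‖ξ‖ ^ 2) ^ (-(sTwoGamma γ ε)) * (1 + ‖vs‖) ^ γ) := by
  obtain ⟨β, q, C₁, hβ, hβ3, hq, hq1, hqs, hcond, hC₁, hw⟩ := exists_wGamma_le hγl hε
  obtain ⟨c, hc, hc1, hnu⟩ := exists_le_nu hγl hγu hB₀
  obtain ⟨K, hK, hJ⟩ :=
    lintegral_norm_rpow_mul_exp_div_le (half_pos hα₁) hβ hβ3 hq hq1 hcond
  set N : ℝ := 1 + |2 * γ - 1| + 2 * |γ| with hN
  have hN0 : 0 ≤ N := by positivity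
  set M : ℝ := C₀ * C₁ / c ^ 2 * Real.exp (N ^ 2 / (2 * α₁)) with hM
  have hM0 : 0 < M := by positivity
  have hpt : ∀ ξ v vs : E3, v ≠ vs →
      |kα v vs| * (1 + ‖v‖) ^ (2 * γ - 1) / (nu B₀ γ v ^ 2 + ⟪v, ξ⟫ ^ 2) ≤
        M * (1 + ‖vs‖) ^ (3 * γ - 2) *
          (‖v - vs‖ ^ (-β) * Real.exp (-(α₁ / 2) * ‖v - vs‖ ^ 2) /
            (((1 + ‖vs‖) ^ γ) ^ 2 + (⟪v - vs, ξ⟫ + ⟪vs, ξ⟫) ^ 2)) := by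
    intro ξ v vs hne
    rw [← inner_add_left, sub_add_cancel]
    have hr : 0 < ‖v - vs‖ := norm_pos_iff.2 (sub_ne_zero.2 hne)
    have hV : 0 < 1 + ‖vs‖ := by positivity
    have hP := one_add_norm_rpow_le_mul (2 * γ - 1) v vs
    have hD := div_nu_sq_add_sq_le (x := ⟪v, ξ⟫) hc hc1 v vs (hnu v)
    have hE := one_add_rpow_mul_exp_le hN0 hα₁ hr.le
    have hW := hw _ hr
    have hk := hb1 v vs hne
    set r := ‖v - vs‖ with hrdef
    set V := 1 + ‖vs‖ with hVdef
    have hS : (1 + ‖v‖ + ‖vs‖) ^ (γ - 1) ≤ V ^ (γ - 1) :=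
      Real.rpow_le_rpow_of_nonpos hV (by linarith [norm_nonneg v]) (by linarith)
    set T := 1 / ((V ^ γ) ^ 2 + ⟪v, ξ⟫ ^ 2) with hT
    have hT0 : 0 ≤ T := by positivity
    have hk' : |kα v vs| ≤ C₀ * (C₁ * r ^ (-β) * (1 + r)) * V ^ (γ - 1) *
        Real.exp (-α₁ * r ^ 2) := by
      refine hk.trans ?_
      gcongr
    have eV : V ^ (3 * γ - 2) = V ^ (γ - 1) * V ^ (2 * γ - 1) := by
      rw [← Real.rpow_add hV]; ring_nf
    have er : (1 + r) ^ N = (1 + r) * (1 + r) ^ |2 * γ - 1| * (1 + r) ^ (2 * |γ|) := by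
      rw [hN, Real.rpow_add (by positivity), Real.rpow_add (by positivity), Real.rpow_one]
    calc _ = |kα v vs| * (1 + ‖v‖) ^ (2 * γ - 1) *
          (1 / (nu B₀ γ v ^ 2 + ⟪v, ξ⟫ ^ 2)) := by ring
      _ ≤ (C₀ * (C₁ * r ^ (-β) * (1 + r)) * V ^ (γ - 1) * Real.exp (-α₁ * r ^ 2)) *
          (V ^ (2 * γ - 1) * (1 + r) ^ |2 * γ - 1|) * ((1 + r) ^ (2 * |γ|) / c ^ 2 * T) := by
          gcongr
      _ = C₀ * C₁ / c ^ 2 * V ^ (3 * γ - 2) * r ^ (-β) * T *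
          ((1 + r) ^ N * Real.exp (-α₁ * r ^ 2)) := by
          rw [eV, er]; ring
      _ ≤ C₀ * C₁ / c ^ 2 * V ^ (3 * γ - 2) * r ^ (-β) * T *
          (Real.exp (N ^ 2 / (2 * α₁)) * Real.exp (-(α₁ / 2) * r ^ 2)) := by
          gcongr
      _ = _ := by rw [hM, hT]; ring
  have hint : ∀ ξ vs : E3, ∫⁻ v : E3, ENNReal.ofReal
      (|kα v vs| * (1 + ‖v‖) ^ (2 * γ - 1) / (nu B₀ γ v ^ 2 + ⟪v, ξ⟫ ^ 2)) ≤
        ENNReal.ofReal (M * (1 + ‖vs‖) ^ (3 * γ - 2)) * ∫⁻ u : E3, ENNReal.ofReal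
          (‖u‖ ^ (-β) * Real.exp (-(α₁ / 2) * ‖u‖ ^ 2) /
            (((1 + ‖vs‖) ^ γ) ^ 2 + (⟪u, ξ⟫ + ⟪vs, ξ⟫) ^ 2)) := by
    intro ξ vs
    rw [← lintegral_sub_right_eq_self (fun u : E3 => ENNReal.ofReal
      (‖u‖ ^ (-β) * Real.exp (-(α₁ / 2) * ‖u‖ ^ 2) /
        (((1 + ‖vs‖) ^ γ) ^ 2 + (⟪u, ξ⟫ + ⟪vs, ξ⟫) ^ 2))) vs,
      ← lintegral_const_mul' _ _ ENNReal.ofReal_ne_top]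
    refine lintegral_mono_ae ?_
    filter_upwards [Measure.ae_ne volume vs] with v hv
    rw [← ENNReal.ofReal_mul (by positivity)]
    exact ENNReal.ofReal_le_ofReal (hpt ξ v vs hv)
  have hs0 : 0 < sTwoGamma γ ε := by linarith
  have hs1 : sTwoGamma γ ε ≤ 1 := by linarith
  refine ⟨2 * M * K, by positivity, fun ξ vs => (hint ξ vs).trans ?_⟩
  have hV : 0 < 1 + ‖vs‖ := by positivity
  have hV1 : 1 ≤ 1 + ‖vs‖ := by linarith [norm_nonneg vs]
  obtain ⟨hsmall, hlarge⟩ := rpow_neg_le_two_mul hs0 hs1 (norm_nonneg ξ)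
  obtain ⟨hJ1, hJ2⟩ := hJ ((1 + ‖vs‖) ^ γ) ⟪vs, ξ⟫ ξ (by positivity)
  set V := 1 + ‖vs‖ with hVdef
  rcases le_or_gt ‖ξ‖ 1 with hξ | hξ
  · refine (mul_le_mul_right hJ1 _).trans ?_
    rw [← ENNReal.ofReal_mul (by positivity)]
    apply ENNReal.ofReal_le_ofReal
    have e : V ^ (3 * γ - 2) * (V ^ γ) ^ (-2 : ℝ) ≤ V ^ γ := by
      rw [← Real.rpow_mul hV.le, ← Real.rpow_add hV]
      exact Real.rpow_le_rpow_of_exponent_le hV1 (by linarith)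
    calc _ = M * K * (V ^ (3 * γ - 2) * (V ^ γ) ^ (-2 : ℝ)) * 1 := by ring
      _ ≤ M * K * V ^ γ * (2 * (1 + ‖ξ‖ ^ 2) ^ (-sTwoGamma γ ε)) := by
          gcongr
          exact hsmall hξ
      _ = _ := by ring
  · have hξ0 : ξ ≠ 0 := norm_pos_iff.1 (by linarith)
    refine (mul_le_mul_right (hJ2 hξ0) _).trans ?_
    rw [← ENNReal.ofReal_mul (by positivity)]
    apply ENNReal.ofReal_le_ofReal
    have e : V ^ (3 * γ - 2) * (V ^ γ) ^ (q - 2) ≤ V ^ γ := by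
      rw [← Real.rpow_mul hV.le, ← Real.rpow_add hV]
      exact Real.rpow_le_rpow_of_exponent_le hV1 (by nlinarith)
    calc _ = M * K * (V ^ (3 * γ - 2) * (V ^ γ) ^ (q - 2)) * ‖ξ‖ ^ (-q) := by ring
      _ ≤ M * K * V ^ γ * (2 * (1 + ‖ξ‖ ^ 2) ^ (-sTwoGamma γ ε)) := by
          gcongr
          rw [hqs]
          exact hlarge hξ
      _ = _ := by ring
end
end

section
/- Let Ω ⊆ ℝ³ be a bounded open set, R > 0, and 0 < s < 1, and let B_R ⊆ ℝ³ be the open ball of radius R centered at the origin. Then there exists a constant C > 0, depending only on s, such that for every measurable f : Ω × B_R → ℝ, ∫_Ω ∫_{B_R} ∫_Ω ∫_{B_R} |f(x, v) − f(y, u)|² / (|x − y|² + |v − u|²)^{3+s} du dx dv dy ≤ C ( ∫_{B_R} ∫_Ω ∫_Ω |f(x, v) − f(y, v)|² / |x − y|^{3+2s} dx dy dv + ∫_Ω ∫_{B_R} ∫_{B_R} |f(y, v) − f(y, u)|² / |v − u|^{3+2s} dv du dy ). -/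
open MeasureTheory Real Set
open scoped ENNReal

noncomputable section

/-- Scaling of the convolution kernel `(a² + |v - u|²)^(-p)` in the variable `u`. -/
theorem lintegral_one_div_sq_add_norm_sub_sq_rpow {E : Type*} [NormedAddCommGroup E]
    [NormedSpace ℝ E] [FiniteDimensional ℝ E] [MeasurableSpace E] [BorelSpace E]
    (μ : Measure E) [μ.IsAddHaarMeasure] {a : ℝ} (ha : 0 < a) (p : ℝ) (v : E) :
    ∫⁻ u, ENNReal.ofReal (1 / (a ^ 2 + ‖v - u‖ ^ 2) ^ p) ∂μ =
      ENNReal.ofReal (a ^ (Module.finrank ℝ E - 2 * p)) *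
        ∫⁻ w, ENNReal.ofReal (1 / (1 + ‖w‖ ^ 2) ^ p) ∂μ := by
  have hscale (w : E) : ENNReal.ofReal (1 / (a ^ 2 + ‖w‖ ^ 2) ^ p) =
      ENNReal.ofReal (a ^ (-(2 * p))) *
        ENNReal.ofReal (1 / (1 + ‖a⁻¹ • w‖ ^ 2) ^ p) := by
    rw [← ENNReal.ofReal_mul (by positivity)]
    congr 1
    have h : a ^ 2 + ‖w‖ ^ 2 = a ^ 2 * (1 + ‖a⁻¹ • w‖ ^ 2) := by
      rw [norm_smul, Real.norm_of_nonneg (by positivity)]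
      field_simp
    rw [h, Real.mul_rpow (by positivity) (by positivity), Real.rpow_neg ha.le, Real.rpow_mul ha.le,
      Real.rpow_two, one_div, mul_inv, one_div]
  have hmeas : Measurable fun w : E ↦ ENNReal.ofReal (1 / (1 + ‖w‖ ^ 2) ^ p) := by fun_prop
  have hpow : a ^ (Module.finrank ℝ E - 2 * p) =
      a ^ (-(2 * p)) * a ^ Module.finrank ℝ E := by
    rw [← Real.rpow_natCast, ← Real.rpow_add ha]
    ring_nf
  calc ∫⁻ u, ENNReal.ofReal (1 / (a ^ 2 + ‖v - u‖ ^ 2) ^ p) ∂μ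
      = ∫⁻ w, ENNReal.ofReal (1 / (a ^ 2 + ‖w‖ ^ 2) ^ p) ∂μ :=
        lintegral_sub_left_eq_self (μ := μ)
          (fun w ↦ ENNReal.ofReal (1 / (a ^ 2 + ‖w‖ ^ 2) ^ p)) v
    _ = ENNReal.ofReal (a ^ (-(2 * p))) *
          ∫⁻ w, ENNReal.ofReal (1 / (1 + ‖a⁻¹ • w‖ ^ 2) ^ p) ∂μ := by
        simp_rw [hscale]
        rw [lintegral_const_mul _ (by fun_prop)]
    _ = _ := by
        rw [← lintegral_map (f := fun w : E ↦ ENNReal.ofReal (1 / (1 + ‖w‖ ^ 2) ^ p))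
            (g := fun w : E ↦ a⁻¹ • w) hmeas (by fun_prop),
          Measure.map_addHaar_smul μ (inv_ne_zero ha.ne'), lintegral_smul_measure, hpow,
          ENNReal.ofReal_mul (by positivity), smul_eq_mul, mul_assoc, inv_pow, inv_inv,
          abs_of_pos (by positivity)]

theorem lintegral_one_div_one_add_norm_sq_rpow_lt_top {E : Type*} [NormedAddCommGroup E]
    [NormedSpace ℝ E] [FiniteDimensional ℝ E] [MeasurableSpace E] [BorelSpace E]
    (μ : Measure E) [μ.IsAddHaarMeasure] {p : ℝ} (hp : Module.finrank ℝ E < 2 * p) :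
    ∫⁻ w, ENNReal.ofReal (1 / (1 + ‖w‖ ^ 2) ^ p) ∂μ < ∞ := by
  have h := (integrable_rpow_neg_one_add_norm_sq (μ := μ) hp).lintegral_lt_top
  refine lt_of_le_of_lt (lintegral_mono fun w ↦ le_of_eq ?_) h
  rw [one_div, ← Real.rpow_neg (by positivity)]
  ring_nf

/-- The weight of the Gagliardo seminorm on a product, integrated over one factor, is bounded by
the weight on the other factor. -/
theorem setLIntegral_div_sq_norm_add_sq_norm_rpow_le {E F : Type*} [NormedAddCommGroup E]
    [NormedAddCommGroup F] [NormedSpace ℝ F] [FiniteDimensional ℝ F] [MeasurableSpace F]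
    [BorelSpace F] (μ : Measure F) [μ.IsAddHaarMeasure] (p : ℝ) (B : Set F) {c : ℝ}
    (hc : 0 ≤ c) {z : E} (hz : z = 0 → c = 0) (v : F) :
    ∫⁻ u in B, ENNReal.ofReal (c / (‖z‖ ^ 2 + ‖v - u‖ ^ 2) ^ p) ∂μ ≤
      (∫⁻ w, ENNReal.ofReal (1 / (1 + ‖w‖ ^ 2) ^ p) ∂μ) *
        ENNReal.ofReal (c / ‖z‖ ^ (2 * p - Module.finrank ℝ F)) := by
  obtain rfl | hz0 := eq_or_ne z 0
  · simp [hz rfl]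
  have ha : 0 < ‖z‖ := norm_pos_iff.2 hz0
  refine (setLIntegral_le_lintegral _ _).trans (le_of_eq ?_)
  simp_rw [div_eq_mul_one_div c, ENNReal.ofReal_mul hc]
  rw [lintegral_const_mul _ (by fun_prop), lintegral_one_div_sq_add_norm_sub_sq_rpow μ ha,
    one_div (‖z‖ ^ _), ← Real.rpow_neg ha.le, neg_sub]
  ring

theorem lintegral_four_rotate {α β γ δ : Type*} [MeasurableSpace α] [MeasurableSpace β]
    [MeasurableSpace γ] [MeasurableSpace δ] (μ : Measure α) (ν : Measure β) (ρ : Measure γ)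
    (τ : Measure δ) [SFinite μ] [SFinite ν] [SFinite ρ] [SFinite τ]
    {g : α → β → γ → δ → ℝ≥0∞}
    (hg : Measurable fun q : α × β × γ × δ ↦ g q.1 q.2.1 q.2.2.1 q.2.2.2) :
    ∫⁻ x, ∫⁻ v, ∫⁻ y, ∫⁻ u, g x v y u ∂τ ∂ρ ∂ν ∂μ =
      ∫⁻ y, ∫⁻ v, ∫⁻ u, ∫⁻ x, g x v y u ∂μ ∂τ ∂ν ∂ρ := by
  have hu : Measurable fun q : α × β × γ ↦ ∫⁻ u, g q.1 q.2.1 q.2.2 u ∂τ :=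
    Measurable.lintegral_prod_right' (ν := τ)
      (f := fun q : (α × β × γ) × δ ↦ g q.1.1 q.1.2.1 q.1.2.2 q.2)
      (hg.comp (f := fun q : (α × β × γ) × δ ↦ (q.1.1, q.1.2.1, q.1.2.2, q.2)) (by fun_prop))
  have huy : Measurable fun q : α × β ↦ ∫⁻ y, ∫⁻ u, g q.1 q.2 y u ∂τ ∂ρ :=
    Measurable.lintegral_prod_right' (ν := ρ)
      (f := fun q : (α × β) × γ ↦ ∫⁻ u, g q.1.1 q.1.2 q.2 u ∂τ)
      (hu.comp (f := fun q : (α × β) × γ ↦ (q.1.1, q.1.2, q.2)) (by fun_prop))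
  have hux : Measurable fun q : β × γ ↦ ∫⁻ x, ∫⁻ u, g x q.1 q.2 u ∂τ ∂μ :=
    Measurable.lintegral_prod_right' (ν := μ)
      (f := fun q : (β × γ) × α ↦ ∫⁻ u, g q.2 q.1.1 q.1.2 u ∂τ)
      (hu.comp (f := fun q : (β × γ) × α ↦ (q.2, q.1.1, q.1.2)) (by fun_prop))
  rw [lintegral_lintegral_swap huy.aemeasurable]
  calc _ = ∫⁻ v, ∫⁻ y, ∫⁻ x, ∫⁻ u, g x v y u ∂τ ∂μ ∂ρ ∂ν := by
        refine lintegral_congr fun v ↦ lintegral_lintegral_swap (Measurable.aemeasurable ?_)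
        exact hu.comp (f := fun q : α × γ ↦ (q.1, v, q.2)) (by fun_prop)
    _ = ∫⁻ y, ∫⁻ v, ∫⁻ x, ∫⁻ u, g x v y u ∂τ ∂μ ∂ν ∂ρ :=
        lintegral_lintegral_swap hux.aemeasurable
    _ = _ := by
        refine lintegral_congr fun y ↦ lintegral_congr fun v ↦
          lintegral_lintegral_swap (Measurable.aemeasurable ?_)
        exact hg.comp (f := fun q : α × δ ↦ (q.1, v, y, q.2)) (by fun_prop)

theorem lintegral_four_add_left {α β γ δ : Type*} [MeasurableSpace α] [MeasurableSpace β]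
    [MeasurableSpace γ] [MeasurableSpace δ] (μ : Measure α) (ν : Measure β) (ρ : Measure γ)
    (τ : Measure δ) [SFinite ν] [SFinite ρ] [SFinite τ] {g : α → β → γ → δ → ℝ≥0∞}
    (hg : Measurable fun q : α × β × γ × δ ↦ g q.1 q.2.1 q.2.2.1 q.2.2.2)
    (h : α → β → γ → δ → ℝ≥0∞) :
    ∫⁻ x, ∫⁻ v, ∫⁻ y, ∫⁻ u, (g x v y u + h x v y u) ∂τ ∂ρ ∂ν ∂μ =
      ∫⁻ x, ∫⁻ v, ∫⁻ y, ∫⁻ u, g x v y u ∂τ ∂ρ ∂ν ∂μ +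
        ∫⁻ x, ∫⁻ v, ∫⁻ y, ∫⁻ u, h x v y u ∂τ ∂ρ ∂ν ∂μ := by
  have hu : Measurable fun q : α × β × γ ↦ ∫⁻ u, g q.1 q.2.1 q.2.2 u ∂τ :=
    Measurable.lintegral_prod_right' (ν := τ)
      (f := fun q : (α × β × γ) × δ ↦ g q.1.1 q.1.2.1 q.1.2.2 q.2)
      (hg.comp (f := fun q : (α × β × γ) × δ ↦ (q.1.1, q.1.2.1, q.1.2.2, q.2)) (by fun_prop))
  have hy : Measurable fun q : α × β ↦ ∫⁻ y, ∫⁻ u, g q.1 q.2 y u ∂τ ∂ρ :=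
    Measurable.lintegral_prod_right' (ν := ρ)
      (f := fun q : (α × β) × γ ↦ ∫⁻ u, g q.1.1 q.1.2 q.2 u ∂τ)
      (hu.comp (f := fun q : (α × β) × γ ↦ (q.1.1, q.1.2, q.2)) (by fun_prop))
  refine (lintegral_congr fun x ↦ ?_).trans
    (lintegral_add_left (Measurable.lintegral_prod_right' (ν := ν) hy) _)
  refine (lintegral_congr fun v ↦ ?_).trans
    (lintegral_add_left (hy.comp (f := fun v : β ↦ (x, v)) (by fun_prop)) _)
  refine (lintegral_congr fun y ↦ ?_).trans
    (lintegral_add_left (hu.comp (f := fun y : γ ↦ (x, v, y)) (by fun_prop)) _)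
  exact lintegral_add_left (hg.comp (f := fun u : δ ↦ (x, v, y, u)) (by fun_prop)) _

theorem ofReal_sub_sq_div_le (a b c : ℝ) {d : ℝ} (hd : 0 ≤ d) :
    ENNReal.ofReal ((a - c) ^ 2 / d) ≤
      2 * (ENNReal.ofReal ((a - b) ^ 2 / d) + ENNReal.ofReal ((b - c) ^ 2 / d)) := by
  rw [← ENNReal.ofReal_add (by positivity) (by positivity), ← ENNReal.ofReal_ofNat,
    ← ENNReal.ofReal_mul (by norm_num), ← add_div, ← mul_div_assoc]
  gcongr
  nlinarith [sq_nonneg (a - b - (b - c))]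

/-- The Gagliardo seminorm on the product `Ω × B_R ⊆ ℝ⁶` is controlled by the partial
Gagliardo seminorms in each group of variables:
`L²_v(B_R; H^s_x(Ω)) ∩ L²_x(Ω; H^s_v(B_R)) ⊆ H^s(Ω × B_R)`. -/
theorem product_fractional_sobolev_inclusion (s : ℝ) (hs1 : 0 < s) (hs2 : s < 1) :
    ∃ C > (0 : ℝ), ∀ Ω : Set E3, IsOpen Ω → Bornology.IsBounded Ω →
      ∀ R : ℝ, 0 < R → ∀ f : E3 → E3 → ℝ, Measurable (Function.uncurry f) →
        (∫⁻ x in Ω, ∫⁻ v in Metric.ball (0 : E3) R, ∫⁻ y in Ω,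
            ∫⁻ u in Metric.ball (0 : E3) R, ENNReal.ofReal
              ((f x v - f y u) ^ 2 / (‖x - y‖ ^ 2 + ‖v - u‖ ^ 2) ^ (3 + s))) ≤
          ENNReal.ofReal C *
            ((∫⁻ v in Metric.ball (0 : E3) R, ∫⁻ x in Ω, ∫⁻ y in Ω, ENNReal.ofReal
                ((f x v - f y v) ^ 2 / ‖x - y‖ ^ (3 + 2 * s))) +
              ∫⁻ y in Ω, ∫⁻ v in Metric.ball (0 : E3) R,
                ∫⁻ u in Metric.ball (0 : E3) R, ENNReal.ofReal
                  ((f y v - f y u) ^ 2 / ‖v - u‖ ^ (3 + 2 * s))) := by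
  set K : ℝ≥0∞ := ∫⁻ w : E3, ENNReal.ofReal (1 / (1 + ‖w‖ ^ 2) ^ (3 + s)) with hK
  have hKtop : K < ∞ := by
    refine lintegral_one_div_one_add_norm_sq_rpow_lt_top _ ?_
    rw [finrank_euclideanSpace_fin]
    push_cast
    linarith
  have hexp : 2 * (3 + s) - (Module.finrank ℝ E3 : ℝ) = 3 + 2 * s := by
    rw [finrank_euclideanSpace_fin]
    push_cast
    ring
  refine ⟨2 * K.toReal + 1, by positivity, fun Ω _ _ R _ f hf ↦ ?_⟩
  have hfm {α : Type} [MeasurableSpace α] {g h : α → E3} (hg : Measurable g)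
      (hh : Measurable h) : Measurable fun a ↦ f (g a) (h a) := hf.comp (hg.prodMk hh)
  have hC : 2 * K ≤ ENNReal.ofReal (2 * K.toReal + 1) := by
    calc 2 * K = ENNReal.ofReal (2 * K.toReal) := by
          rw [ENNReal.ofReal_mul (by norm_num), ENNReal.ofReal_toReal hKtop.ne,
            ENNReal.ofReal_ofNat]
      _ ≤ _ := by gcongr; linarith
  set B : Set E3 := Metric.ball 0 R
  set D : E3 → E3 → E3 → E3 → ℝ := fun x v y u ↦ (‖x - y‖ ^ 2 + ‖v - u‖ ^ 2) ^ (3 + s) with hD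
  have hmeas₁ : Measurable fun q : E3 × E3 × E3 × E3 ↦
      ENNReal.ofReal ((f q.1 q.2.1 - f q.2.2.1 q.2.1) ^ 2 / D q.1 q.2.1 q.2.2.1 q.2.2.2) := by
    have h1 : Measurable fun q : E3 × E3 × E3 × E3 ↦ f q.1 q.2.1 :=
      hfm (by fun_prop) (by fun_prop)
    have h2 : Measurable fun q : E3 × E3 × E3 × E3 ↦ f q.2.2.1 q.2.1 :=
      hfm (by fun_prop) (by fun_prop)
    fun_prop
  have hmeas₂ : Measurable fun q : E3 × E3 × E3 × E3 ↦
      ENNReal.ofReal ((f q.2.2.1 q.2.1 - f q.2.2.1 q.2.2.2) ^ 2 /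
        D q.1 q.2.1 q.2.2.1 q.2.2.2) := by
    have h1 : Measurable fun q : E3 × E3 × E3 × E3 ↦ f q.2.2.1 q.2.2.2 :=
      hfm (by fun_prop) (by fun_prop)
    have h2 : Measurable fun q : E3 × E3 × E3 × E3 ↦ f q.2.2.1 q.2.1 :=
      hfm (by fun_prop) (by fun_prop)
    fun_prop
  have hx : (∫⁻ x in Ω, ∫⁻ v in B, ∫⁻ y in Ω, ∫⁻ u in B,
        ENNReal.ofReal ((f x v - f y v) ^ 2 / D x v y u)) ≤
      K * ∫⁻ v in B, ∫⁻ x in Ω, ∫⁻ y in Ω,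
        ENNReal.ofReal ((f x v - f y v) ^ 2 / ‖x - y‖ ^ (3 + 2 * s)) := by
    have hm : Measurable fun q : (E3 × E3) × E3 ↦
        ENNReal.ofReal ((f q.1.1 q.1.2 - f q.2 q.1.2) ^ 2 / ‖q.1.1 - q.2‖ ^ (3 + 2 * s)) := by
      have h1 : Measurable fun q : (E3 × E3) × E3 ↦ f q.1.1 q.1.2 :=
        hfm (by fun_prop) (by fun_prop)
      have h2 : Measurable fun q : (E3 × E3) × E3 ↦ f q.2 q.1.2 :=
        hfm (by fun_prop) (by fun_prop)
      fun_prop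
    rw [← lintegral_lintegral_swap (μ := volume.restrict Ω) (ν := volume.restrict B)
      (f := fun x v ↦ ∫⁻ y in Ω, ENNReal.ofReal ((f x v - f y v) ^ 2 / ‖x - y‖ ^ (3 + 2 * s)))
      (Measurable.lintegral_prod_right' (ν := volume.restrict Ω) hm).aemeasurable]
    simp_rw [← lintegral_const_mul' K _ hKtop.ne]
    refine lintegral_mono fun x ↦ lintegral_mono fun v ↦ lintegral_mono fun y ↦ ?_
    have h := setLIntegral_div_sq_norm_add_sq_norm_rpow_le (volume : Measure E3) (3 + s) B
      (sq_nonneg (f x v - f y v)) (z := x - y) (fun h ↦ by simp [sub_eq_zero.1 h]) v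
    rwa [hexp] at h
  have hv : (∫⁻ x in Ω, ∫⁻ v in B, ∫⁻ y in Ω, ∫⁻ u in B,
        ENNReal.ofReal ((f y v - f y u) ^ 2 / D x v y u)) ≤
      K * ∫⁻ y in Ω, ∫⁻ v in B, ∫⁻ u in B,
        ENNReal.ofReal ((f y v - f y u) ^ 2 / ‖v - u‖ ^ (3 + 2 * s)) := by
    rw [lintegral_four_rotate _ _ _ _ hmeas₂]
    simp_rw [← lintegral_const_mul' K _ hKtop.ne]
    refine lintegral_mono fun y ↦ lintegral_mono fun v ↦ lintegral_mono fun u ↦ ?_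
    have h := setLIntegral_div_sq_norm_add_sq_norm_rpow_le (volume : Measure E3) (3 + s) Ω
      (sq_nonneg (f y v - f y u)) (z := v - u) (fun h ↦ by simp [sub_eq_zero.1 h]) y
    rw [hexp] at h
    simpa only [hD, hK, add_comm, norm_sub_rev] using h
  calc _ ≤ ∫⁻ x in Ω, ∫⁻ v in B, ∫⁻ y in Ω, ∫⁻ u in B,
        2 * (ENNReal.ofReal ((f x v - f y v) ^ 2 / D x v y u) +
          ENNReal.ofReal ((f y v - f y u) ^ 2 / D x v y u)) := by
        refine lintegral_mono fun x ↦ lintegral_mono fun v ↦ lintegral_mono fun y ↦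
          lintegral_mono fun u ↦ ofReal_sub_sq_div_le _ _ _ (by positivity)
    _ ≤ 2 * (K * _ + K * _) := by
        simp_rw [lintegral_const_mul' 2 _ ENNReal.ofNat_ne_top]
        rw [lintegral_four_add_left _ _ _ _ hmeas₁]
        gcongr
    _ ≤ _ := by
        rw [← mul_add, ← mul_assoc]
        gcongr
end
end
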